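/- arXiv:1711.10512 — 8 statements merged into one kernel-verified Lean document; each statement's English description precedes it below -/
import Mathlib

section
/- For every real m ≥ 1, Θ_m is faithful: for every d×d density matrix ρ one has Θ_m(ρ) ≥ 0, and Θ_m(ρ) = 0 if and only if ρ is diagonal, i.e. ρ = Δ(ρ). -/
open Matrix Kronecker BigOperators ComplexOrder

/-- The completely dephasing map Δ, sending a matrix to its diagonal part. -/
noncomputable def deph {n : ℕ} (A : Matrix (Fin n) (Fin n) ℂ) : Matrix (Fin n) (Fin n) ℂ :=
  Matrix.diagonal (fun i => A i i)

/-- A density matrix: positive semidefinite with unit trace. -/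
def IsDensity {n : ℕ} (ρ : Matrix (Fin n) (Fin n) ℂ) : Prop :=
  ρ.PosSemidef ∧ ρ.trace = 1

/-- Θ_m(ρ) = sup { Re Tr(ρW) : W Hermitian, −𝟙 ≤ W ≤ m𝟙, Δ(W) ≤ 0 }. -/
noncomputable def Theta {d : ℕ} (m : ℝ) (ρ : Matrix (Fin d) (Fin d) ℂ) : ℝ :=
  sSup {x : ℝ | ∃ W : Matrix (Fin d) (Fin d) ℂ, W.IsHermitian ∧
    (W + 1).PosSemidef ∧ ((m : ℂ) • (1 : Matrix (Fin d) (Fin d) ℂ) - W).PosSemidef ∧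
    (-(deph W)).PosSemidef ∧ x = ((ρ * W).trace).re}

/-- The trace of a product of two positive semidefinite matrices is nonnegative. -/
lemma Matrix.PosSemidef.trace_mul_nonneg {n : ℕ} {A B : Matrix (Fin n) (Fin n) ℂ}
    (hA : A.PosSemidef) (hB : B.PosSemidef) : 0 ≤ (A * B).trace := by
  have h := hA.isHermitian.spectral_theorem
  rw [Unitary.conjStarAlgAut_apply] at h
  generalize hA.isHermitian.eigenvectorUnitary = U at h
  rw [h, Matrix.mul_assoc, Matrix.mul_assoc, Matrix.trace_mul_comm, Matrix.mul_assoc,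
    Matrix.trace]
  refine Finset.sum_nonneg fun i _ => ?_
  rw [Matrix.diag_apply, Matrix.diagonal_mul]
  refine mul_nonneg ?_ ?_
  · simpa using hA.eigenvalues_nonneg i
  · simpa [Matrix.mul_assoc, star_eq_conjTranspose] using
      (hB.conjTranspose_mul_mul_same (U : Matrix (Fin n) (Fin n) ℂ)).diag_nonneg (i := i)

/-- A density matrix is bounded above by the identity. -/
lemma IsDensity.posSemidef_one_sub {n : ℕ} {ρ : Matrix (Fin n) (Fin n) ℂ} (hρ : IsDensity ρ) :
    (1 - ρ).PosSemidef := by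
  obtain ⟨hp, ht⟩ := hρ
  have hsum : ∑ i, hp.isHermitian.eigenvalues i = 1 := by
    rw [hp.isHermitian.trace_eq_sum_eigenvalues] at ht
    simpa using congrArg Complex.re ht
  have hle (i) : hp.isHermitian.eigenvalues i ≤ 1 := hsum ▸
    Finset.single_le_sum (fun j _ => hp.eigenvalues_nonneg j) (Finset.mem_univ i)
  have hdiag : (diagonal (fun i => (1 : ℂ) - hp.isHermitian.eigenvalues i)).PosSemidef := by
    rw [posSemidef_diagonal_iff]
    intro i
    rw [sub_nonneg]
    exact_mod_cast hle i
  have hconj : 1 - ρ = Unitary.conjStarAlgAut ℂ _ hp.isHermitian.eigenvectorUnitary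
      (diagonal (fun i => (1 : ℂ) - hp.isHermitian.eigenvalues i)) := by
    rw [← diagonal_sub, map_sub]
    conv_lhs => rw [hp.isHermitian.spectral_theorem]
    rw [diagonal_one, map_one]
    rfl
  rw [hconj, Unitary.conjStarAlgAut_apply]
  exact hdiag.mul_mul_conjTranspose_same _

/-- The trace of a diagonal matrix times a matrix only sees the diagonals. -/
lemma trace_deph_mul {n : ℕ} (A B : Matrix (Fin n) (Fin n) ℂ) :
    (deph A * B).trace = ∑ i, A i i * B i i := by
  simp [deph, Matrix.trace, Matrix.diagonal_mul]

/-- The set of values whose supremum is `Theta m ρ`. -/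
def thetaValues {d : ℕ} (m : ℝ) (ρ : Matrix (Fin d) (Fin d) ℂ) : Set ℝ :=
  {x : ℝ | ∃ W : Matrix (Fin d) (Fin d) ℂ, W.IsHermitian ∧
    (W + 1).PosSemidef ∧ ((m : ℂ) • (1 : Matrix (Fin d) (Fin d) ℂ) - W).PosSemidef ∧
    (-(deph W)).PosSemidef ∧ x = ((ρ * W).trace).re}

lemma zero_mem_thetaValues {d : ℕ} {m : ℝ} (hm : 0 ≤ m) (ρ : Matrix (Fin d) (Fin d) ℂ) :
    0 ∈ thetaValues m ρ := by
  refine ⟨0, isHermitian_zero, by simpa using PosSemidef.one, ?_, ?_, by simp⟩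
  · rw [sub_zero]
    exact PosSemidef.one.smul (by exact_mod_cast hm)
  · simpa [deph] using PosSemidef.zero

lemma IsDensity.bddAbove_thetaValues {d : ℕ} (m : ℝ) {ρ : Matrix (Fin d) (Fin d) ℂ}
    (hρ : IsDensity ρ) : BddAbove (thetaValues m ρ) := by
  refine ⟨m, ?_⟩
  rintro x ⟨W, -, -, hW, -, rfl⟩
  have h := (Complex.nonneg_iff.mp (hρ.1.trace_mul_nonneg hW)).1
  simpa [mul_sub, trace_sub, hρ.2] using h

/-- The off-diagonal part of a density matrix is a feasible witness. -/
lemma IsDensity.offDiag_mem_thetaValues {d : ℕ} {m : ℝ} (hm : 1 ≤ m)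
    {ρ : Matrix (Fin d) (Fin d) ℂ} (hρ : IsDensity ρ) :
    ((ρ * (ρ - deph ρ)).trace).re ∈ thetaValues m ρ := by
  have hle := hρ.posSemidef_one_sub
  have hdeph : (deph ρ).PosSemidef := posSemidef_diagonal_iff.mpr fun i => hρ.1.diag_nonneg
  refine ⟨ρ - deph ρ, hρ.1.isHermitian.sub hdeph.isHermitian, ?_, ?_, ?_, rfl⟩
  · have h : (1 - deph ρ).PosSemidef := by
      rw [deph, ← diagonal_one, diagonal_sub, posSemidef_diagonal_iff]
      intro i
      simpa using hle.diag_nonneg (i := i)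
    convert hρ.1.add h using 1
    abel
  · have h : (((m - 1 : ℝ) : ℂ) • (1 : Matrix (Fin d) (Fin d) ℂ)).PosSemidef :=
      PosSemidef.one.smul (by exact_mod_cast sub_nonneg.mpr hm)
    convert (h.add hle).add hdeph using 1
    push_cast
    rw [sub_smul, one_smul]
    abel
  · have h : deph (ρ - deph ρ) = 0 := by simp [deph]
    rw [h, neg_zero]
    exact PosSemidef.zero

/-- A Hermitian matrix with nonpositive overlap with its off-diagonal part is diagonal. -/
lemma Matrix.IsHermitian.eq_deph_of_trace_nonpos {n : ℕ} {ρ : Matrix (Fin n) (Fin n) ℂ}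
    (hρ : ρ.IsHermitian) (h : ((ρ * (ρ - deph ρ)).trace).re ≤ 0) : ρ = deph ρ := by
  have hdeph : (deph ρ).IsHermitian := by
    refine isHermitian_diagonal_of_self_adjoint _ (funext fun i => ?_)
    exact hρ.apply i i
  have hW : (ρ - deph ρ)ᴴ = ρ - deph ρ := (hρ.sub hdeph).eq
  have htr : (ρ * (ρ - deph ρ)).trace = ((ρ - deph ρ)ᴴ * (ρ - deph ρ)).trace := by
    rw [hW, sub_mul, trace_sub, trace_deph_mul]
    simp [deph]
  rw [htr] at h
  have hnn := Complex.nonneg_iff.mp (posSemidef_conjTranspose_mul_self (ρ - deph ρ)).trace_nonneg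
  rw [← sub_eq_zero, ← trace_conjTranspose_mul_self_eq_zero_iff]
  exact Complex.ext (le_antisymm h hnn.1) hnn.2.symm

/-- Θ_m is faithful: Θ_m(ρ) ≥ 0, with equality iff ρ is diagonal. -/
theorem theta_faithful {d : ℕ} (m : ℝ) (hm : 1 ≤ m)
    (ρ : Matrix (Fin d) (Fin d) ℂ) (hρ : IsDensity ρ) :
    0 ≤ Theta m ρ ∧ (Theta m ρ = 0 ↔ ρ = deph ρ) := by
  have hΘ : Theta m ρ = sSup (thetaValues m ρ) := rfl
  have hbdd := hρ.bddAbove_thetaValues m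
  have hzero := zero_mem_thetaValues (zero_le_one.trans hm) ρ
  have hnonneg : 0 ≤ Theta m ρ := hΘ ▸ le_csSup hbdd hzero
  refine ⟨hnonneg, fun h => ?_, fun h => le_antisymm ?_ hnonneg⟩
  · refine hρ.1.isHermitian.eq_deph_of_trace_nonpos ?_
    rw [← h, hΘ]
    exact le_csSup hbdd (hρ.offDiag_mem_thetaValues hm)
  · rw [hΘ]
    refine csSup_le ⟨0, hzero⟩ ?_
    rintro x ⟨W, -, -, -, hW, rfl⟩
    rw [h, trace_deph_mul]
    have hnp : ∑ i, ρ i i * W i i ≤ 0 := by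
      refine Finset.sum_nonpos fun i _ => mul_nonpos_of_nonneg_of_nonpos hρ.1.diag_nonneg ?_
      simpa [deph] using hW.diag_nonneg (i := i)
    exact (Complex.nonpos_iff.mp hnp).1
end

section
/- For m = d − 1 the upper constraint in the definition of Θ_m is redundant and Θ_{d−1} equals the robustness of coherence: for every d×d density matrix ρ, Θ_{d−1}(ρ) = sup { Re Tr(ρW) : W Hermitian, −𝟙 ≤ W, Δ(W) ≤ 0 }. -/
open Matrix Kronecker BigOperators ComplexOrder

/-- A positive semidefinite matrix is dominated by its trace times the identity. -/
lemma Matrix.PosSemidef.trace_smul_one_sub {n : Type*} [Fintype n] [DecidableEq n]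
    {P : Matrix n n ℂ} (hP : P.PosSemidef) :
    (P.trace • (1 : Matrix n n ℂ) - P).PosSemidef := by
  have hdiag : (Matrix.diagonal
      (fun i => P.trace - (hP.isHermitian.eigenvalues i : ℂ))).PosSemidef := by
    refine Matrix.posSemidef_diagonal_iff.mpr fun i => sub_nonneg.mpr ?_
    rw [hP.isHermitian.trace_eq_sum_eigenvalues]
    exact Finset.single_le_sum
      (f := fun j => (hP.isHermitian.eigenvalues j : ℂ))
      (fun j _ => Complex.zero_le_real.mpr (hP.eigenvalues_nonneg j)) (Finset.mem_univ i)
  have hconj := hdiag.mul_mul_conjTranspose_same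
    (hP.isHermitian.eigenvectorUnitary : Matrix n n ℂ)
  convert hconj using 1
  have hspec := hP.isHermitian.spectral_theorem
  rw [Unitary.conjStarAlgAut_apply, Matrix.star_eq_conjTranspose] at hspec
  have hunit : (hP.isHermitian.eigenvectorUnitary : Matrix n n ℂ) *
      (hP.isHermitian.eigenvectorUnitary : Matrix n n ℂ)ᴴ = 1 :=
    Unitary.coe_mul_star_self hP.isHermitian.eigenvectorUnitary
  have hsplit : Matrix.diagonal (fun i => P.trace - (hP.isHermitian.eigenvalues i : ℂ)) =
      P.trace • (1 : Matrix n n ℂ) -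
        Matrix.diagonal (RCLike.ofReal ∘ hP.isHermitian.eigenvalues) := by
    rw [Matrix.smul_one_eq_diagonal, Matrix.diagonal_sub]
    rfl
  rw [hsplit, Matrix.mul_sub, Matrix.sub_mul, ← hspec, Matrix.mul_smul, Matrix.mul_one,
    Matrix.smul_mul, hunit]

/-- If `-1 ≤ W` and the diagonal of `W` is nonpositive, then `W ≤ d - 1`. -/
lemma posSemidef_card_sub_one_smul_one_sub {d : ℕ} {W : Matrix (Fin d) (Fin d) ℂ}
    (hlower : (W + 1).PosSemidef) (hdiag : (-(deph W)).PosSemidef) :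
    ((((d : ℝ) - 1 : ℝ) : ℂ) • (1 : Matrix (Fin d) (Fin d) ℂ) - W).PosSemidef := by
  have htrace : 0 ≤ -W.trace := by
    simpa [deph, Matrix.trace] using hdiag.trace_nonneg
  have hsum := hlower.trace_smul_one_sub.add (Matrix.PosSemidef.one.smul htrace)
  convert hsum using 1
  rw [Matrix.trace_add, Matrix.trace_one, Fintype.card_fin]
  push_cast
  module

/-- for m = d − 1 the upper constraint is redundant and Θ_{d−1} equals the
robustness of coherence R_I(ρ) = sup { Re Tr(ρW) : W Hermitian, −𝟙 ≤ W, Δ(W) ≤ 0 }. -/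
theorem theta_eq_robustness {d : ℕ} (hd : 1 ≤ d)
    (ρ : Matrix (Fin d) (Fin d) ℂ) (hρ : IsDensity ρ) :
    Theta ((d : ℝ) - 1) ρ =
      sSup {x : ℝ | ∃ W : Matrix (Fin d) (Fin d) ℂ, W.IsHermitian ∧
        (W + 1).PosSemidef ∧ (-(deph W)).PosSemidef ∧ x = ((ρ * W).trace).re} := by
  unfold Theta
  congr 1
  ext x
  constructor
  · rintro ⟨W, hW, hlower, -, hdiag, hx⟩
    exact ⟨W, hW, hlower, hdiag, hx⟩
  · rintro ⟨W, hW, hlower, hdiag, hx⟩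
    exact ⟨W, hW, hlower, posSemidef_card_sub_one_smul_one_sub hlower hdiag, hdiag, hx⟩
end

section
/- Strong Lagrange duality for Θ_m: for every real m ≥ 1 and every d×d density matrix ρ, Θ_m(ρ) = inf { m·Tr(ρ − X)_+ + Tr(ρ − X)_− : X positive semidefinite and diagonal }, where (A)_+ and (A)_− denote respectively the positive and negative parts of the Hermitian matrix A (so A = (A)_+ − (A)_− with both parts positive semidefinite and mutually orthogonal). -/
open Matrix Kronecker BigOperators ComplexOrder

/-- Existence of Lagrange multipliers for a linear program over a convex set with linear
inequality constraints satisfying Slater's condition. -/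
theorem exists_lagrange_multiplier {E ι : Type*} [AddCommGroup E] [Module ℝ E] [Fintype ι]
    {K : Set E} (hK : Convex ℝ K) (g : E →ₗ[ℝ] ℝ) (h : ι → E →ₗ[ℝ] ℝ) {θ : ℝ}
    (hθ : ∀ w ∈ K, (∀ i, h i w ≤ 0) → g w ≤ θ) (slater : ∃ w ∈ K, ∀ i, h i w < 0) :
    ∃ x : ι → ℝ, (∀ i, 0 ≤ x i) ∧ ∀ w ∈ K, g w - ∑ i, x i * h i w ≤ θ := by
  classical
  let C : Set (ℝ × (ι → ℝ)) := {p | ∃ w ∈ K, p.1 < g w ∧ ∀ i, h i w < p.2 i}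
  have hC : Convex ℝ C := by
    rintro p ⟨v, hv, hvg, hvh⟩ q ⟨w, hw, hwg, hwh⟩ a b ha hb hab
    refine ⟨a • v + b • w, hK hv hw ha hb hab, ?_, fun i => ?_⟩
    · simp only [Prod.fst_add, Prod.smul_fst, smul_eq_mul, map_add, map_smul]
      rcases ha.eq_or_lt with rfl | ha'
      · obtain rfl : b = 1 := by linarith
        simpa using hwg
      · have := mul_lt_mul_of_pos_left hvg ha'
        have := mul_le_mul_of_nonneg_left hwg.le hb
        linarith
    · simp only [Prod.snd_add, Prod.smul_snd, Pi.add_apply, Pi.smul_apply, smul_eq_mul, map_add,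
        map_smul]
      rcases ha.eq_or_lt with rfl | ha'
      · obtain rfl : b = 1 := by linarith
        simpa using hwh i
      · have := mul_lt_mul_of_pos_left (hvh i) ha'
        have := mul_le_mul_of_nonneg_left (hwh i).le hb
        linarith
  have hCo : IsOpen C := by
    have : C = ⋃ w ∈ K, {p : ℝ × (ι → ℝ) | p.1 < g w ∧ ∀ i, h i w < p.2 i} := by
      ext p
      simp only [C, Set.mem_ofPred_eq, Set.mem_iUnion, exists_prop]
    rw [this]
    refine isOpen_biUnion fun w _ => ?_
    simp only [Set.ofPred_and, Set.ofPred_forall]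
    exact (isOpen_lt (by fun_prop) (by fun_prop)).inter
      (isOpen_iInter_of_finite fun i => isOpen_lt (by fun_prop) (by fun_prop))
  have hθC : ((θ, 0) : ℝ × (ι → ℝ)) ∉ C := by
    rintro ⟨w, hw, hwg, hwh⟩
    exact (hθ w hw fun i => (hwh i).le).not_gt hwg
  obtain ⟨f, hf⟩ := geometric_hahn_banach_open_point hC hCo hθC
  set c : ℝ := f (1, 0)
  set y : ι → ℝ := fun i => f (0, Pi.single i 1)
  have f_apply (t : ℝ) (u : ι → ℝ) : f (t, u) = t * c + ∑ i, u i * y i := by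
    have : ((t, u) : ℝ × (ι → ℝ)) = t • (1, 0) + ∑ i, u i • (0, Pi.single i 1) := by
      ext j
      · simp [Prod.fst_sum]
      · simp [Prod.snd_sum, Finset.sum_apply, Pi.single_apply]
    rw [this, map_add, map_sum, map_smul, smul_eq_mul]
    exact congrArg _ (Finset.sum_congr rfl fun i _ => by rw [map_smul, smul_eq_mul])
  simp only [Prod.forall, f_apply] at hf
  simp only [Pi.zero_apply, zero_mul, Finset.sum_const_zero, add_zero] at hf
  -- A functional bounded above along a ray has nonpositive slope.
  have slope {a s B : ℝ} (hB : ∀ r : ℝ, 0 ≤ r → a + r * s < B) : s ≤ 0 := by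
    by_contra! hs
    have h0 := hB 0 le_rfl
    have := hB ((B - a) / s) (div_nonneg (by linarith) hs.le)
    rw [div_mul_cancel₀ _ hs.ne'] at this
    linarith
  obtain ⟨w₀, hw₀, hw₀h⟩ := slater
  have hc0 : 0 ≤ c := by
    have : -c ≤ 0 := slope (a := (g w₀ - 1) * c + ∑ i, (h i w₀ + 1) * y i) (B := θ * c)
      fun r hr => by
        have := hf (g w₀ - 1 - r) (fun i => h i w₀ + 1)
          ⟨w₀, hw₀, by simp only; linarith, fun i => by simp⟩
        linarith
    linarith
  have hy0 (j : ι) : y j ≤ 0 :=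
    slope (a := (g w₀ - 1) * c + ∑ i, (h i w₀ + 1) * y i) (B := θ * c) fun r hr => by
      have := hf (g w₀ - 1) (fun i => h i w₀ + 1 + (Pi.single j r : ι → ℝ) i)
        ⟨w₀, hw₀, by simp, fun i => by
          have : 0 ≤ (Pi.single j r : ι → ℝ) i := by
            rw [Pi.single_apply]; split_ifs <;> simp [hr]
          simp only; linarith⟩
      simp only [add_mul, Finset.sum_add_distrib, Pi.single_apply, ite_mul,
        zero_mul, Finset.sum_ite_eq', Finset.mem_univ, if_true] at this ⊢
      linarith
  have hcpos : 0 < c := by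
    refine hc0.lt_of_ne fun hc' => ?_
    have := hf (g w₀ - 1) (fun i => h i w₀ / 2)
      ⟨w₀, hw₀, by simp, fun i => by simp only; linarith [hw₀h i]⟩
    rw [← hc', mul_zero, mul_zero, zero_add] at this
    exact this.not_ge (Finset.sum_nonneg fun i _ =>
      mul_nonneg_of_nonpos_of_nonpos (by linarith [hw₀h i]) (hy0 i))
  refine ⟨fun i => -y i / c, fun i => div_nonneg (by linarith [hy0 i]) hc0, fun w hw => ?_⟩
  have key : g w * c + ∑ i, h i w * y i ≤ θ * c := by
    have hlim : Filter.Tendsto (fun ε : ℝ => (g w - ε) * c + ∑ i, (h i w + ε) * y i)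
        (nhdsWithin 0 (Set.Ioi 0)) (nhds ((g w - 0) * c + ∑ i, (h i w + 0) * y i)) :=
      (Continuous.tendsto (by fun_prop) 0).mono_left nhdsWithin_le_nhds
    simp only [sub_zero, add_zero] at hlim
    refine le_of_tendsto hlim (Filter.eventually_of_mem self_mem_nhdsWithin fun ε hε => ?_)
    have hε' : 0 < ε := hε
    exact (hf (g w - ε) (fun i => h i w + ε)
      ⟨w, hw, by simp only; linarith, fun i => by simp only; linarith⟩).le
  have hsum : ∑ i, -y i / c * h i w = -(∑ i, h i w * y i) / c := by
    rw [← Finset.sum_neg_distrib, Finset.sum_div]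
    exact Finset.sum_congr rfl fun i _ => by ring
  rw [hsum, ← mul_le_mul_iff_left₀ hcpos, sub_mul, div_mul_cancel₀ _ hcpos.ne']
  linarith

/-- The trace of a product of two positive semidefinite matrices is nonnegative. -/
theorem Matrix.PosSemidef.trace_mul_re_nonneg {n : Type*} [Fintype n]
    {A B : Matrix n n ℂ} (hA : A.PosSemidef) (hB : B.PosSemidef) : 0 ≤ (A * B).trace.re := by
  classical
  obtain ⟨C, rfl⟩ : ∃ C : Matrix n n ℂ, A = Cᴴ * C := by
    open scoped MatrixOrder in
    exact CStarAlgebra.nonneg_iff_eq_star_mul_self.mp hA.nonneg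
  rw [Matrix.mul_assoc, Matrix.trace_mul_comm]
  exact (Complex.nonneg_iff.mp (hB.mul_mul_conjTranspose_same C).trace_nonneg).1

/-- The orthogonal decomposition `A = P - N` of a Hermitian matrix, together with a matrix `W`
between `-1` and `m` attaining `Tr (A W) = m Tr P + Tr N`. -/
theorem Matrix.IsHermitian.exists_posPart_negPart_optimizer {n : Type*} [Fintype n] [DecidableEq n]
    {A : Matrix n n ℂ} (hA : A.IsHermitian) {m : ℝ} (hm : -1 ≤ m) :
    ∃ P N W : Matrix n n ℂ, P.PosSemidef ∧ N.PosSemidef ∧ A = P - N ∧ P * N = 0 ∧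
      W.IsHermitian ∧ (W + 1).PosSemidef ∧ ((m : ℂ) • (1 : Matrix n n ℂ) - W).PosSemidef ∧
      (A * W).trace.re = m * P.trace.re + N.trace.re := by
  set φ := Unitary.conjStarAlgAut ℂ (Matrix n n ℂ) hA.eigenvectorUnitary with hφ
  set e := hA.eigenvalues
  let D (a : n → ℝ) : Matrix n n ℂ := φ (diagonal fun i => (a i : ℂ))
  have hAD : A = D e := hA.spectral_theorem
  have D_psd {a : n → ℝ} (ha : ∀ i, 0 ≤ a i) : (D a).PosSemidef := by
    simp only [D, hφ, Unitary.conjStarAlgAut_apply]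
    exact (PosSemidef.diagonal fun i => by simpa using ha i).mul_mul_conjTranspose_same _
  have D_trace (a : n → ℝ) : (D a).trace.re = ∑ i, a i := by
    simp only [D, hφ, Unitary.conjStarAlgAut_apply]
    rw [trace_mul_cycle, Unitary.coe_star_mul_self, one_mul, trace_diagonal]
    simp
  have D_mul (a b : n → ℝ) : D a * D b = D (a * b) := by
    simp [D, ← map_mul]
  have D_sub (a b : n → ℝ) : D a - D b = D (a - b) := by
    simp [D, ← map_sub]
  have D_const (r : ℝ) : D (fun _ => r) = (r : ℂ) • (1 : Matrix n n ℂ) := by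
    simp only [D]
    rw [← smul_one_eq_diagonal, map_smul, map_one]
  let a : n → ℝ := fun i => if 0 < e i then m else -1
  have hW : (D a + 1).PosSemidef := by
    have : D a + 1 = D (a - fun _ => -1) := by rw [← D_sub, D_const]; simp
    rw [this]
    refine D_psd fun i => ?_
    simp only [Pi.sub_apply, a]
    split_ifs <;> linarith
  refine ⟨D e⁺, D e⁻, D a, D_psd fun i => posPart_nonneg _, D_psd fun i => negPart_nonneg _,
    ?_, ?_, ?_, hW, ?_, ?_⟩
  · rw [D_sub, posPart_sub_negPart, hAD]
  · have : e⁺ * e⁻ = 0 := by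
      ext i
      rcases le_total 0 (e i) with h | h <;> simp [h]
    rw [D_mul, this]
    simp [D]
  · simpa using hW.1.sub isHermitian_one
  · rw [← D_const, D_sub]
    refine D_psd fun i => ?_
    simp only [Pi.sub_apply, a]
    split_ifs <;> linarith
  · rw [hAD, D_mul, D_trace, D_trace, D_trace, Finset.mul_sum, ← Finset.sum_add_distrib]
    refine Finset.sum_congr rfl fun i _ => ?_
    simp only [Pi.mul_apply, a, Pi.posPart_apply, Pi.negPart_apply]
    split_ifs with h
    · rw [posPart_eq_self.mpr h.le, negPart_eq_zero.mpr h.le]; ring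
    · rw [posPart_eq_zero.mpr (not_lt.mp h), negPart_eq_neg.mpr (not_lt.mp h)]; ring

/-- Pairing a diagonal matrix with `W` only sees the diagonal of `W`. -/
theorem trace_deph_mul_re {d : ℕ} {X W : Matrix (Fin d) (Fin d) ℂ} (hX : X.PosSemidef)
    (hXd : X = deph X) : (X * W).trace.re = ∑ i, (X i i).re * (W i i).re := by
  rw [hXd, deph, trace]
  simp only [diag_apply, diagonal_mul, Complex.re_sum, diagonal_apply_eq]
  refine Finset.sum_congr rfl fun i _ => ?_
  have := (Complex.nonneg_iff.mp (hX.diag_nonneg (i := i))).2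
  simp [Complex.mul_re, ← this]

/-- The diagonal entries of `W` are nonpositive iff its dephasing is negative semidefinite. -/
theorem neg_deph_posSemidef_iff {d : ℕ} {W : Matrix (Fin d) (Fin d) ℂ} (hW : W.IsHermitian) :
    (-(deph W)).PosSemidef ↔ ∀ i, (W i i).re ≤ 0 := by
  rw [deph, diagonal_neg, posSemidef_diagonal_iff]
  refine forall_congr' fun i => ?_
  have := congrArg Complex.im (hW.apply i i)
  simp only [RCLike.star_def, Complex.conj_im] at this
  rw [Complex.nonneg_iff]
  simp only [Complex.neg_re, Complex.neg_im]
  constructor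
  · rintro ⟨h, -⟩; linarith
  · intro h; constructor <;> linarith

/-- Weak duality: every feasible `W` is dominated by every dual feasible point. -/
theorem trace_mul_re_le_dual_value {d : ℕ} {m : ℝ} {ρ W X P N : Matrix (Fin d) (Fin d) ℂ}
    (hW : W.IsHermitian) (hW₁ : (W + 1).PosSemidef)
    (hWm : ((m : ℂ) • (1 : Matrix (Fin d) (Fin d) ℂ) - W).PosSemidef)
    (hWd : (-(deph W)).PosSemidef) (hX : X.PosSemidef) (hXd : X = deph X)
    (hP : P.PosSemidef) (hN : N.PosSemidef) (hPN : ρ - X = P - N) :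
    (ρ * W).trace.re ≤ m * P.trace.re + N.trace.re := by
  have hρ : ρ = X + P - N := by rw [add_sub_assoc, ← hPN]; abel
  have hXW : (X * W).trace.re ≤ 0 := by
    rw [trace_deph_mul_re hX hXd]
    exact Finset.sum_nonpos fun i _ => mul_nonpos_of_nonneg_of_nonpos
      (Complex.nonneg_iff.mp hX.diag_nonneg).1 ((neg_deph_posSemidef_iff hW).mp hWd i)
  have h₁ := hP.trace_mul_re_nonneg hWm
  have h₂ := hN.trace_mul_re_nonneg hW₁
  simp only [mul_sub, mul_add, mul_smul_comm, mul_one, trace_sub, trace_add, trace_smul,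
    smul_eq_mul, Complex.sub_re, Complex.add_re, Complex.re_ofReal_mul] at h₁ h₂
  rw [hρ]
  simp only [sub_mul, add_mul, trace_sub, trace_add, Complex.sub_re, Complex.add_re]
  linarith

/-- strong Lagrange duality for Θ_m:
Θ_m(ρ) = inf { m·Tr(ρ−X)_+ + Tr(ρ−X)_− : X diagonal PSD }, where (ρ−X) = P − N is the
unique decomposition into mutually orthogonal positive and negative parts P, N. -/
theorem theta_duality {d : ℕ} (m : ℝ) (hm : 1 ≤ m)
    (ρ : Matrix (Fin d) (Fin d) ℂ) (hρ : IsDensity ρ) :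
    Theta m ρ =
      sInf {x : ℝ | ∃ X P N : Matrix (Fin d) (Fin d) ℂ,
        X.PosSemidef ∧ X = deph X ∧
        P.PosSemidef ∧ N.PosSemidef ∧ ρ - X = P - N ∧ P * N = 0 ∧
        x = m * P.trace.re + N.trace.re} := by
  rw [Theta]
  set S := {x : ℝ | ∃ W : Matrix (Fin d) (Fin d) ℂ, W.IsHermitian ∧
    (W + 1).PosSemidef ∧ ((m : ℂ) • (1 : Matrix (Fin d) (Fin d) ℂ) - W).PosSemidef ∧
    (-(deph W)).PosSemidef ∧ x = ((ρ * W).trace).re}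
  set T := {x : ℝ | ∃ X P N : Matrix (Fin d) (Fin d) ℂ,
    X.PosSemidef ∧ X = deph X ∧
    P.PosSemidef ∧ N.PosSemidef ∧ ρ - X = P - N ∧ P * N = 0 ∧
    x = m * P.trace.re + N.trace.re}
  have weak : ∀ s ∈ S, ∀ t ∈ T, s ≤ t := by
    rintro _ ⟨W, hW, hW₁, hWm, hWd, rfl⟩ _ ⟨X, P, N, hX, hXd, hP, hN, hPN, -, rfl⟩
    exact trace_mul_re_le_dual_value hW hW₁ hWm hWd hX hXd hP hN hPN
  have neg_one_herm : (-1 : Matrix (Fin d) (Fin d) ℂ).IsHermitian := isHermitian_one.neg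
  have neg_one_le : (-1 + 1 : Matrix (Fin d) (Fin d) ℂ).PosSemidef := by
    simpa using PosSemidef.zero
  have le_neg_one : ((m : ℂ) • (1 : Matrix (Fin d) (Fin d) ℂ) - -1).PosSemidef := by
    have h0 : (0 : ℂ) ≤ m := by exact_mod_cast (by linarith : (0 : ℝ) ≤ m)
    rw [sub_neg_eq_add]
    exact (PosSemidef.one.smul h0).add PosSemidef.one
  have hSne : S.Nonempty := ⟨_, -1, neg_one_herm, neg_one_le, le_neg_one,
    (neg_deph_posSemidef_iff neg_one_herm).mpr fun i => by simp, rfl⟩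
  have hTne : T.Nonempty := ⟨_, 0, ρ, 0, .zero, by simp [deph], hρ.1, .zero, rfl, mul_zero _, rfl⟩
  have hSbdd : BddAbove S := hTne.imp fun t ht s hs => weak s hs t ht
  have hTbdd : BddBelow T := hSne.imp fun s hs t ht => weak s hs t ht
  refine le_antisymm (csSup_le hSne fun s hs => le_csInf hTne fun t ht => weak s hs t ht) ?_
  let K : Set (Matrix (Fin d) (Fin d) ℂ) := {W | W.IsHermitian ∧ (W + 1).PosSemidef ∧
    ((m : ℂ) • (1 : Matrix (Fin d) (Fin d) ℂ) - W).PosSemidef}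
  have hK : Convex ℝ K := by
    rintro V ⟨hV, hV₁, hVm⟩ W ⟨hW, hW₁, hWm⟩ a b ha hb hab
    have hab' : (1 : Matrix (Fin d) (Fin d) ℂ) = a • 1 + b • 1 := by
      rw [← add_smul, hab, one_smul]
    have h₁ : (a • V + b • W + 1).PosSemidef := by
      convert (hV₁.smul ha).add (hW₁.smul hb) using 1
      nth_rewrite 1 [hab']
      module
    refine ⟨by simpa using h₁.1.sub isHermitian_one, h₁, ?_⟩
    convert (hVm.smul ha).add (hWm.smul hb) using 1
    nth_rewrite 1 [hab']
    module
  let g : Matrix (Fin d) (Fin d) ℂ →ₗ[ℝ] ℝ :=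
    Complex.reLm ∘ₗ traceLinearMap (Fin d) ℝ ℂ ∘ₗ LinearMap.mulLeft ℝ ρ
  let h (i : Fin d) : Matrix (Fin d) (Fin d) ℂ →ₗ[ℝ] ℝ :=
    Complex.reLm ∘ₗ entryLinearMap ℝ ℂ i i
  obtain ⟨x, hx, hxK⟩ := exists_lagrange_multiplier hK g h (θ := sSup S)
    (fun W ⟨hW, hW₁, hWm⟩ hWd => le_csSup hSbdd
      ⟨W, hW, hW₁, hWm, (neg_deph_posSemidef_iff hW).mpr hWd, rfl⟩)
    ⟨-1, ⟨neg_one_herm, neg_one_le, le_neg_one⟩, fun i => by simp [h]⟩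
  let X : Matrix (Fin d) (Fin d) ℂ := diagonal fun i => (x i : ℂ)
  have hX : X.PosSemidef := PosSemidef.diagonal fun i => by simpa using hx i
  have hXd : X = deph X := by simp [X, deph]
  obtain ⟨P, N, W, hP, hN, hPN, hPN0, hW, hW₁, hWm, htr⟩ :=
    (hρ.1.1.sub hX.1).exists_posPart_negPart_optimizer (m := m) (by linarith)
  refine (csInf_le hTbdd ⟨X, P, N, hX, hXd, hP, hN, hPN, hPN0, rfl⟩).trans ?_
  rw [← htr, sub_mul, trace_sub, Complex.sub_re, trace_deph_mul_re hX hXd]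
  simpa [X, g, h] using hxK W ⟨hW, hW₁, hWm⟩
end

section
/- For every unit vector ψ ∈ ℂ^d and every real m ≥ 1, Θ_{m−1}(ψψ*) = ‖ψ‖_[m]² − 1, where ψψ* is the rank-one density matrix associated with ψ. (Here Θ_0(ρ) := sup { Re Tr(ρW) : W Hermitian, −𝟙 ≤ W ≤ 0, Δ(W) ≤ 0 } when m = 1.) -/
open Matrix Kronecker BigOperators ComplexOrder

/-- The m-distillation norm ‖ψ‖_[m] = inf { ‖x‖₁ + √m ‖y‖₂ : x + y = ψ }. -/
noncomputable def mnorm {d : ℕ} (m : ℝ) (ψ : Fin d → ℂ) : ℝ :=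
  sInf {r : ℝ | ∃ x y : Fin d → ℂ, x + y = ψ ∧
    r = (∑ i, ‖x i‖) + Real.sqrt m * Real.sqrt (∑ i, ‖y i‖ ^ 2)}

/-- The rank-one density matrix ψψ* associated with a vector ψ. -/
noncomputable def outer {d : ℕ} (ψ : Fin d → ℂ) : Matrix (Fin d) (Fin d) ℂ :=
  Matrix.of fun i j => ψ i * star (ψ j)

theorem mnorm_set_bddBelow {d : ℕ} (m : ℝ) (ψ : Fin d → ℂ) :
    BddBelow {r : ℝ | ∃ x y : Fin d → ℂ, x + y = ψ ∧
      r = (∑ i, ‖x i‖) + Real.sqrt m * Real.sqrt (∑ i, ‖y i‖ ^ 2)} := by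
  refine ⟨0, ?_⟩
  rintro r ⟨x, y, -, rfl⟩
  positivity

theorem mnorm_add_le {d : ℕ} (m : ℝ) (x y : Fin d → ℂ) :
    mnorm m (x + y) ≤ (∑ i, ‖x i‖) + Real.sqrt m * Real.sqrt (∑ i, ‖y i‖ ^ 2) :=
  csInf_le (mnorm_set_bddBelow m _) ⟨x, y, rfl, rfl⟩

theorem le_mnorm {d : ℕ} {m c : ℝ} {ψ : Fin d → ℂ}
    (h : ∀ x y : Fin d → ℂ, x + y = ψ →
      c ≤ (∑ i, ‖x i‖) + Real.sqrt m * Real.sqrt (∑ i, ‖y i‖ ^ 2)) :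
    c ≤ mnorm m ψ := by
  refine le_csInf ⟨_, ψ, 0, add_zero ψ, rfl⟩ ?_
  rintro r ⟨x, y, hxy, rfl⟩
  exact h x y hxy

theorem mnorm_nonneg {d : ℕ} (m : ℝ) (ψ : Fin d → ℂ) : 0 ≤ mnorm m ψ :=
  le_mnorm fun _ _ _ => by positivity

theorem mnorm_le_l1 {d : ℕ} (m : ℝ) (ψ : Fin d → ℂ) : mnorm m ψ ≤ ∑ i, ‖ψ i‖ := by
  simpa using mnorm_add_le m ψ 0

theorem mnorm_le_l2 {d : ℕ} (m : ℝ) (ψ : Fin d → ℂ) :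
    mnorm m ψ ≤ Real.sqrt m * Real.sqrt (∑ i, ‖ψ i‖ ^ 2) := by
  simpa using mnorm_add_le m 0 ψ

theorem sqrt_sum_norm_sq_eq_norm {d : ℕ} (v : Fin d → ℂ) :
    Real.sqrt (∑ i, ‖v i‖ ^ 2) = ‖WithLp.toLp 2 v‖ := by
  rw [EuclideanSpace.norm_eq]

theorem mnorm_triangle {d : ℕ} (m : ℝ) (u v : Fin d → ℂ) :
    mnorm m (u + v) ≤ mnorm m u + mnorm m v := by
  rw [← sub_le_iff_le_add]
  refine le_mnorm fun x y hxy => ?_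
  rw [sub_le_comm]
  refine le_mnorm fun x' y' hxy' => ?_
  rw [sub_le_iff_le_add]
  have h := mnorm_add_le m (x + x') (y + y')
  rw [add_add_add_comm, hxy, hxy'] at h
  have h1 : ∑ i, ‖(x + x') i‖ ≤ (∑ i, ‖x i‖) + ∑ i, ‖x' i‖ := by
    rw [← Finset.sum_add_distrib]
    exact Finset.sum_le_sum fun i _ => norm_add_le _ _
  have h2 : Real.sqrt (∑ i, ‖(y + y') i‖ ^ 2) ≤
      Real.sqrt (∑ i, ‖y i‖ ^ 2) + Real.sqrt (∑ i, ‖y' i‖ ^ 2) := by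
    simp only [sqrt_sum_norm_sq_eq_norm]
    exact norm_add_le (WithLp.toLp 2 y) (WithLp.toLp 2 y')
  have h3 := mul_le_mul_of_nonneg_left h2 (Real.sqrt_nonneg m)
  linarith

theorem mnorm_smul_le {d : ℕ} (m : ℝ) {c : ℝ} (hc : 0 < c) (ψ : Fin d → ℂ) :
    mnorm m (c • ψ) ≤ c * mnorm m ψ := by
  rw [← div_le_iff₀' hc]
  refine le_mnorm fun x y hxy => ?_
  rw [div_le_iff₀' hc]
  have h := mnorm_add_le m (c • x) (c • y)
  rw [← smul_add, hxy] at h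
  have h1 : ∑ i, ‖(c • x) i‖ = c * ∑ i, ‖x i‖ := by
    simp [Finset.mul_sum, abs_of_pos hc]
  have h2 : Real.sqrt (∑ i, ‖(c • y) i‖ ^ 2) = c * Real.sqrt (∑ i, ‖y i‖ ^ 2) := by
    simp only [sqrt_sum_norm_sq_eq_norm, WithLp.toLp_smul, norm_smul, Real.norm_eq_abs,
      abs_of_pos hc]
  rw [h1, h2] at h
  linarith

theorem mnorm_smul {d : ℕ} (m : ℝ) {c : ℝ} (hc : 0 < c) (ψ : Fin d → ℂ) :
    mnorm m (c • ψ) = c * mnorm m ψ := by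
  refine le_antisymm (mnorm_smul_le m hc ψ) ?_
  have h := mnorm_smul_le m (inv_pos.2 hc) (c • ψ)
  rwa [inv_smul_smul₀ hc.ne', ← div_eq_inv_mul, le_div_iff₀' hc] at h

/-- A real-linear functional dominated by the distillation norm and attaining it at `ψ`. -/
theorem exists_functional_eq_mnorm {d : ℕ} (m : ℝ) {ψ : Fin d → ℂ} (hψ : ψ ≠ 0) :
    ∃ f : (Fin d → ℂ) →ₗ[ℝ] ℝ, (∀ v, f v ≤ mnorm m v) ∧ f ψ = mnorm m ψ := by
  obtain ⟨g, hg, hgN⟩ := exists_extension_of_le_sublinear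
    (LinearPMap.mkSpanSingleton (K := ℝ) ψ (mnorm m ψ) hψ) (mnorm m)
    (fun c hc x => mnorm_smul m hc x) (mnorm_triangle m) (by
      rintro ⟨x, hx⟩
      obtain ⟨c, rfl⟩ := Submodule.mem_span_singleton.1 hx
      have hc := LinearPMap.mkSpanSingleton'_apply (σ := RingHom.id ℝ) ψ (mnorm m ψ)
        (fun c hc => by simp_all) c hx
      refine hc.trans_le ?_
      rw [RingHom.id_apply, smul_eq_mul]
      rcases lt_or_ge 0 c with hc | hc
      · exact (mnorm_smul m hc ψ).ge
      · exact (mul_nonpos_of_nonpos_of_nonneg hc (mnorm_nonneg m ψ)).trans (mnorm_nonneg m _))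
  refine ⟨g, hgN, ?_⟩
  have h := hg ⟨ψ, Submodule.mem_span_singleton_self ψ⟩
  have h1 := LinearPMap.mkSpanSingleton_apply ℝ ℝ (σ := RingHom.id ℝ) hψ (mnorm m ψ)
  exact h.trans h1

/-- A real-linear functional on `ℂ^d` is the real part of the pairing with a vector. -/
theorem exists_eq_re_star_dotProduct {d : ℕ} (f : (Fin d → ℂ) →ₗ[ℝ] ℝ) :
    ∃ w : Fin d → ℂ, ∀ v, f v = (star w ⬝ᵥ v).re := by
  refine ⟨fun i => ⟨f (Pi.single i 1), f (Pi.single i Complex.I)⟩, fun v => ?_⟩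
  have hv : v = ∑ i, ((v i).re • (Pi.single i 1 : Fin d → ℂ) +
      (v i).im • (Pi.single i Complex.I : Fin d → ℂ)) := by
    ext j
    simp [Finset.sum_apply, Pi.single_apply, Finset.sum_add_distrib, Complex.re_add_im]
  conv_lhs => rw [hv]
  simp only [map_sum, map_add, map_smul, dotProduct, Complex.re_sum]
  refine Finset.sum_congr rfl fun i _ => ?_
  simp
  ring

theorem star_dotProduct_self_eq_sum {d : ℕ} (w : Fin d → ℂ) :
    star w ⬝ᵥ w = ((∑ i, ‖w i‖ ^ 2 : ℝ) : ℂ) := by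
  simp [dotProduct, Complex.conj_mul']

/-- The dual description of the distillation norm is attained. -/
theorem exists_dual_vector_mnorm {d : ℕ} {m : ℝ} (hm : 0 ≤ m) {ψ : Fin d → ℂ} (hψ : ψ ≠ 0) :
    ∃ w : Fin d → ℂ, (∀ i, ‖w i‖ ≤ 1) ∧ ∑ i, ‖w i‖ ^ 2 ≤ m ∧
      (star w ⬝ᵥ ψ).re = mnorm m ψ := by
  obtain ⟨f, hf, hfψ⟩ := exists_functional_eq_mnorm m hψ
  obtain ⟨w, hw⟩ := exists_eq_re_star_dotProduct f
  refine ⟨w, fun i => ?_, ?_, (hw ψ).symm.trans hfψ⟩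
  · have h := (hf (Pi.single i (w i))).trans (mnorm_le_l1 m _)
    have h1 : ∑ j, ‖(Pi.single i (w i) : Fin d → ℂ) j‖ = ‖w i‖ := by
      rw [Finset.sum_eq_single i] <;> simp +contextual
    have h2 : f (Pi.single i (w i)) = ‖w i‖ ^ 2 := by
      rw [hw, dotProduct_single, Pi.star_apply, RCLike.star_def, Complex.conj_mul']
      norm_cast
    rw [h1, h2] at h
    by_contra! hlt
    nlinarith
  · have h := (hf w).trans (mnorm_le_l2 m _)
    rw [hw, star_dotProduct_self_eq_sum, Complex.ofReal_re] at h
    set S := ∑ i, ‖w i‖ ^ 2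
    have hS : 0 ≤ S := by positivity
    by_contra! hlt
    have h1 := Real.sqrt_lt_sqrt hm hlt
    have h2 := Real.mul_self_sqrt hS
    have h3 : 0 < Real.sqrt S := (Real.sqrt_nonneg m).trans_lt h1
    nlinarith

theorem trace_outer_mul {d : ℕ} (ψ : Fin d → ℂ) (A : Matrix (Fin d) (Fin d) ℂ) :
    (outer ψ * A).trace = star ψ ⬝ᵥ A *ᵥ ψ := by
  have h : outer ψ = vecMulVec ψ (star ψ) := rfl
  rw [h, vecMulVec_mul, trace_vecMulVec, dotProduct_comm, dotProduct_mulVec]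

theorem norm_sq_toLp_mulVec {d : ℕ} (B : Matrix (Fin d) (Fin d) ℂ) (v : Fin d → ℂ) :
    star v ⬝ᵥ (Bᴴ * B) *ᵥ v = ((‖WithLp.toLp 2 (B *ᵥ v)‖ ^ 2 : ℝ) : ℂ) := by
  rw [← mulVec_mulVec, dotProduct_mulVec, ← star_mulVec, star_dotProduct_self_eq_sum,
    EuclideanSpace.norm_sq_eq]

open scoped MatrixOrder Matrix.Norms.L2Operator in
theorem exists_eq_conjTranspose_mul_self {d : ℕ} {V : Matrix (Fin d) (Fin d) ℂ}
    (hV : V.PosSemidef) : ∃ B : Matrix (Fin d) (Fin d) ℂ, V = Bᴴ * B :=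
  CStarAlgebra.nonneg_iff_eq_star_mul_self.mp hV.nonneg

theorem quadratic_le_mnorm_sq {d : ℕ} {m : ℝ} (hm : 0 ≤ m) {V : Matrix (Fin d) (Fin d) ℂ}
    (hV : V.PosSemidef) (hVm : ((m : ℂ) • (1 : Matrix (Fin d) (Fin d) ℂ) - V).PosSemidef)
    (hdiag : ∀ i, (V i i).re ≤ 1) (ψ : Fin d → ℂ) :
    (star ψ ⬝ᵥ V *ᵥ ψ).re ≤ mnorm m ψ ^ 2 := by
  obtain ⟨B, rfl⟩ := exists_eq_conjTranspose_mul_self hV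
  rw [norm_sq_toLp_mulVec, Complex.ofReal_re]
  refine pow_le_pow_left₀ (norm_nonneg _) (le_mnorm fun x y hxy => ?_) 2
  rw [← hxy, mulVec_add, WithLp.toLp_add]
  refine (norm_add_le _ _).trans (add_le_add ?_ ?_)
  · have hx : WithLp.toLp 2 (B *ᵥ x) =
        ∑ i, x i • WithLp.toLp 2 (B *ᵥ (Pi.single i (1 : ℂ))) := by
      ext j
      simp [mulVec, dotProduct, mul_comm]
    rw [hx]
    refine (norm_sum_le _ _).trans (Finset.sum_le_sum fun i _ => ?_)
    rw [norm_smul]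
    refine mul_le_of_le_one_right (norm_nonneg _) ?_
    have h := norm_sq_toLp_mulVec B (Pi.single i 1)
    have h1 : star (Pi.single i (1 : ℂ)) ⬝ᵥ (Bᴴ * B) *ᵥ Pi.single i 1 = (Bᴴ * B) i i := by
      rw [← Pi.single_star, star_one, single_one_dotProduct, mulVec_single_one, col_apply]
    have h2 := hdiag i
    rw [← h1, h, Complex.ofReal_re] at h2
    exact (sq_le_one_iff₀ (norm_nonneg _)).1 h2
  · have h := hVm.dotProduct_mulVec_nonneg y
    rw [sub_mulVec, dotProduct_sub, norm_sq_toLp_mulVec, smul_mulVec, one_mulVec,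
      dotProduct_smul, star_dotProduct_self_eq_sum, smul_eq_mul, ← Complex.ofReal_mul,
      ← Complex.ofReal_sub, Complex.zero_le_real] at h
    rw [← Real.sqrt_mul hm]
    exact Real.le_sqrt_of_sq_le (by linarith)

theorem norm_sq_dotProduct_le {d : ℕ} (w v : Fin d → ℂ) :
    ‖star w ⬝ᵥ v‖ ^ 2 ≤ (∑ i, ‖w i‖ ^ 2) * ∑ i, ‖v i‖ ^ 2 := by
  have h := norm_inner_le_norm (𝕜 := ℂ) (WithLp.toLp 2 w) (WithLp.toLp 2 v)
  rw [EuclideanSpace.inner_eq_star_dotProduct, dotProduct_comm] at h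
  have h2 := pow_le_pow_left₀ (norm_nonneg _) h 2
  rwa [mul_pow, EuclideanSpace.norm_sq_eq, EuclideanSpace.norm_sq_eq] at h2

theorem dotProduct_vecMulVec_mulVec {d : ℕ} (w v : Fin d → ℂ) :
    star v ⬝ᵥ vecMulVec w (star w) *ᵥ v = ((‖star w ⬝ᵥ v‖ ^ 2 : ℝ) : ℂ) := by
  have h : star v ⬝ᵥ w = star (star w ⬝ᵥ v) := by rw [star_dotProduct]
  rw [vecMulVec_mulVec, dotProduct_smul, h]
  simp [Complex.conj_mul']

theorem posSemidef_smul_one_sub_vecMulVec {d : ℕ} {m : ℝ} {w : Fin d → ℂ}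
    (hw : ∑ i, ‖w i‖ ^ 2 ≤ m) :
    ((m : ℂ) • (1 : Matrix (Fin d) (Fin d) ℂ) - vecMulVec w (star w)).PosSemidef := by
  refine PosSemidef.of_dotProduct_mulVec_nonneg ?_ fun v => ?_
  · refine IsHermitian.sub ?_ (posSemidef_vecMulVec_self_star w).isHermitian
    simp [IsHermitian, conjTranspose_smul]
  · rw [sub_mulVec, dotProduct_sub, dotProduct_vecMulVec_mulVec, smul_mulVec, one_mulVec,
      dotProduct_smul, star_dotProduct_self_eq_sum, smul_eq_mul, ← Complex.ofReal_mul,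
      ← Complex.ofReal_sub, Complex.zero_le_real, sub_nonneg]
    exact (norm_sq_dotProduct_le w v).trans (by gcongr)

/-- for every unit vector ψ and every real m ≥ 1,
Θ_{m−1}(ψψ*) = ‖ψ‖_[m]² − 1. -/
theorem theta_pure_eq_mnorm {d : ℕ} (ψ : Fin d → ℂ) (hψ : ∑ i, ‖ψ i‖ ^ 2 = 1)
    (m : ℝ) (hm : 1 ≤ m) :
    Theta (m - 1) (outer ψ) = (mnorm m ψ) ^ 2 - 1 := by
  have hψ0 : ψ ≠ 0 := by
    rintro rfl
    simp at hψ
  have hm0 : 0 ≤ m := zero_le_one.trans hm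
  have hsub : ∀ V : Matrix (Fin d) (Fin d) ℂ,
      (((m - 1 : ℝ) : ℂ) • (1 : Matrix (Fin d) (Fin d) ℂ) - (V - 1)) = (m : ℂ) • 1 - V := by
    intro V
    rw [Complex.ofReal_sub, Complex.ofReal_one, sub_smul, one_smul]
    abel
  have htr : ∀ V : Matrix (Fin d) (Fin d) ℂ,
      ((outer ψ * (V - 1)).trace).re = (star ψ ⬝ᵥ V *ᵥ ψ).re - 1 := by
    intro V
    rw [trace_outer_mul, sub_mulVec, dotProduct_sub, one_mulVec, star_dotProduct_self_eq_sum,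
      hψ, Complex.sub_re, Complex.ofReal_one, Complex.one_re]
  obtain ⟨w, hw1, hwm, hwψ⟩ := exists_dual_vector_mnorm hm0 hψ0
  have hupper : ∀ W : Matrix (Fin d) (Fin d) ℂ, (W + 1).PosSemidef →
      (((m - 1 : ℝ) : ℂ) • (1 : Matrix (Fin d) (Fin d) ℂ) - W).PosSemidef →
      (-(deph W)).PosSemidef → ((outer ψ * W).trace).re ≤ mnorm m ψ ^ 2 - 1 := by
    intro W hW hWm hWd
    obtain ⟨V, rfl⟩ : ∃ V, W = V - 1 := ⟨W + 1, (add_sub_cancel_right W 1).symm⟩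
    rw [sub_add_cancel] at hW
    rw [hsub] at hWm
    rw [htr]
    refine sub_le_sub_right (quadratic_le_mnorm_sq hm0 hW hWm (fun i => ?_) ψ) 1
    have h := (Complex.le_def.1 (hWd.diag_nonneg (i := i))).1
    simp [deph] at h
    linarith
  have hpsd := posSemidef_vecMulVec_self_star w
  have hdeph : (-(deph (vecMulVec w (star w) - 1))).PosSemidef := by
    rw [deph, diagonal_neg, posSemidef_diagonal_iff]
    intro i
    have h : -(vecMulVec w (star w) - 1) i i = ((1 - ‖w i‖ ^ 2 : ℝ) : ℂ) := by
      simp [vecMulVec_apply, Complex.mul_conj']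
    change 0 ≤ -(vecMulVec w (star w) - 1) i i
    rw [h, Complex.zero_le_real, sub_nonneg]
    exact pow_le_one₀ (norm_nonneg _) (hw1 i)
  have hherm := hpsd.isHermitian.sub (isHermitian_one (n := Fin d) (α := ℂ))
  have hadd : (vecMulVec w (star w) - 1 + 1).PosSemidef := by rwa [sub_add_cancel]
  have hle : (((m - 1 : ℝ) : ℂ) • (1 : Matrix (Fin d) (Fin d) ℂ) -
      (vecMulVec w (star w) - 1)).PosSemidef := by
    rw [hsub]
    exact posSemidef_smul_one_sub_vecMulVec hwm
  refine IsGreatest.csSup_eq ⟨⟨_, hherm, hadd, hle, hdeph, ?_⟩, ?_⟩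
  · refine le_antisymm ?_ (hupper _ hadd hle hdeph)
    rw [htr, dotProduct_vecMulVec_mulVec, Complex.ofReal_re, ← hwψ]
    refine sub_le_sub_right (sq_le_sq.2 ?_) 1
    rw [abs_norm]
    exact Complex.abs_re_le_norm _
  · rintro x ⟨W, -, hW, hWm, hWd, rfl⟩
    exact hupper W hW hWm hWd
end

section
/- Dual characterization of the m-distillation norm: for every ψ ∈ ℂ^d and every real m ≥ 1, ‖ψ‖_[m] = sup { |⟨x, ψ⟩| : x ∈ ℂ^d, ‖x‖_∞ ≤ 1, ‖x‖₂ ≤ √m }, where ⟨·,·⟩ is the standard inner product and ‖·‖_∞ is the sup-norm. -/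
open Matrix BigOperators

/-- Complementary slackness for the pair of optimization problems defining the norm and its dual:
`a` is the modulus of a dual optimizer and `t * a` the modulus of the `ℓ₂` part of a primal one. -/
theorem exists_threshold {ι : Type*} [Fintype ι] (w : ι → ℝ) (hw : ∀ i, 0 ≤ w i) {m : ℝ}
    (hm : 0 < m) :
    ∃ (a : ι → ℝ) (t : ℝ), 0 ≤ t ∧ (∀ i, 0 ≤ a i) ∧ (∀ i, a i ≤ 1) ∧ ∑ i, a i ^ 2 ≤ m ∧
      t * ∑ i, a i ^ 2 = t * m ∧ (∀ i, t * a i ≤ w i) ∧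
      ∀ i, w i - t * a i + t * a i ^ 2 = a i * w i := by
  set S := ∑ i, (w i)⁻¹
  have hS0 : 0 ≤ S := Finset.sum_nonneg fun i _ => inv_nonneg.2 (hw i)
  have hbig : ∀ i, w i ≠ 0 → 1 ≤ S * w i := fun i hi => by
    have h : (w i)⁻¹ ≤ S :=
      Finset.single_le_sum (f := fun i => (w i)⁻¹) (fun j _ => inv_nonneg.2 (hw j))
        (Finset.mem_univ i)
    calc 1 = (w i)⁻¹ * w i := (inv_mul_cancel₀ hi).symm
      _ ≤ S * w i := mul_le_mul_of_nonneg_right h (hw i)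
  by_cases hc : ∑ i, (min (S * w i) 1) ^ 2 ≤ m
  · refine ⟨fun i => min (S * w i) 1, 0, le_rfl,
      fun i => le_min (mul_nonneg hS0 (hw i)) zero_le_one, fun i => min_le_right _ _, hc,
      by simp, fun i => by simpa using hw i, fun i => ?_⟩
    by_cases hi : w i = 0
    · simp [hi]
    · simp [min_eq_right (hbig i hi)]
  · have hcont : Continuous fun s : ℝ => ∑ i, (min (s * w i) 1) ^ 2 := by fun_prop
    obtain ⟨s, ⟨hs0, -⟩, hs⟩ := intermediate_value_Icc hS0 hcont.continuousOn
      (show m ∈ Set.Icc _ _ from ⟨by simpa using hm.le, (not_le.1 hc).le⟩)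
    simp only at hs
    rcases hs0.eq_or_lt with rfl | hs0
    · simp [hm.ne] at hs
    refine ⟨fun i => min (s * w i) 1, s⁻¹, (inv_pos.2 hs0).le,
      fun i => le_min (mul_nonneg hs0.le (hw i)) zero_le_one, fun i => min_le_right _ _, hs.le,
      by rw [hs], fun i => ?_, fun i => ?_⟩
    · rw [inv_mul_le_iff₀ hs0]
      exact min_le_left _ _
    · rcases min_choice (s * w i) 1 with h | h <;> simp only [h] <;> field_simp <;> ring

/-- Weak duality between the primal and dual problems. -/
theorem norm_sum_conj_mul_add_le {ι : Type*} [Fintype ι] {m : ℝ} (x y z : ι → ℂ)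
    (hz : ∀ i, ‖z i‖ ≤ 1) (hzm : √(∑ i, ‖z i‖ ^ 2) ≤ √m) :
    ‖∑ i, (starRingEnd ℂ) (z i) * (x i + y i)‖ ≤
      ∑ i, ‖x i‖ + √m * √(∑ i, ‖y i‖ ^ 2) :=
  calc ‖∑ i, (starRingEnd ℂ) (z i) * (x i + y i)‖
      ≤ ∑ i, (‖x i‖ + ‖z i‖ * ‖y i‖) := by
        refine norm_sum_le_of_le _ fun i _ => ?_
        rw [mul_add]
        refine (norm_add_le _ _).trans ?_
        simp only [norm_mul, RCLike.norm_conj]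
        gcongr
        exact mul_le_of_le_one_left (norm_nonneg _) (hz i)
    _ = ∑ i, ‖x i‖ + ∑ i, ‖z i‖ * ‖y i‖ := Finset.sum_add_distrib
    _ ≤ ∑ i, ‖x i‖ + √(∑ i, ‖z i‖ ^ 2) * √(∑ i, ‖y i‖ ^ 2) := by
        gcongr
        exact Real.sum_mul_le_sqrt_mul_sqrt _ _ _
    _ ≤ _ := by gcongr

/-- Primal and dual optimizers with equal values. -/
theorem exists_primal_dual_optimizers {ι : Type*} [Fintype ι] (ψ : ι → ℂ) {m : ℝ} (hm : 0 < m) :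
    ∃ x y z : ι → ℂ, x + y = ψ ∧ (∀ i, ‖z i‖ ≤ 1) ∧ √(∑ i, ‖z i‖ ^ 2) ≤ √m ∧
      ∑ i, ‖x i‖ + √m * √(∑ i, ‖y i‖ ^ 2) = ‖∑ i, (starRingEnd ℂ) (z i) * ψ i‖ := by
  obtain ⟨a, t, ht, ha0, ha1, ham, htm, hle, heq⟩ :=
    exists_threshold (fun i => ‖ψ i‖) (fun i => norm_nonneg _) hm
  set u : ι → ℂ := fun i => Complex.exp (Complex.arg (ψ i) * Complex.I)
  have hu : ∀ i, ‖u i‖ = 1 := fun i => Complex.norm_exp_ofReal_mul_I _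
  have hψ : ∀ i, ψ i = (‖ψ i‖ : ℂ) * u i := fun i => (Complex.norm_mul_exp_arg_mul_I _).symm
  have hx : ∀ i, ‖((‖ψ i‖ - t * a i : ℝ) : ℂ) * u i‖ = ‖ψ i‖ - t * a i := fun i => by
    rw [norm_mul, hu, mul_one, Complex.norm_of_nonneg (sub_nonneg.2 (hle i))]
  have hy : ∀ i, ‖((t * a i : ℝ) : ℂ) * u i‖ = t * a i := fun i => by
    rw [norm_mul, hu, mul_one, Complex.norm_of_nonneg (mul_nonneg ht (ha0 i))]
  have hz : ∀ i, ‖(a i : ℂ) * u i‖ = a i := fun i => by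
    rw [norm_mul, hu, mul_one, Complex.norm_of_nonneg (ha0 i)]
  have hinner : ∀ i, (starRingEnd ℂ) ((a i : ℂ) * u i) * ψ i = ((a i * ‖ψ i‖ : ℝ) : ℂ) :=
    fun i => by
      have huu : (starRingEnd ℂ) (u i) * u i = 1 := by simp [Complex.conj_mul', hu]
      conv_lhs => rw [hψ i]
      rw [map_mul, Complex.conj_ofReal]
      push_cast
      linear_combination (a i * ‖ψ i‖ : ℂ) * huu
  refine ⟨fun i => ((‖ψ i‖ - t * a i : ℝ) : ℂ) * u i, fun i => ((t * a i : ℝ) : ℂ) * u i,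
    fun i => (a i : ℂ) * u i, ?_, fun i => (hz i).trans_le (ha1 i), ?_, ?_⟩
  · funext i
    conv_rhs => rw [hψ i]
    simp only [Pi.add_apply]
    push_cast
    ring
  · simp only [hz]
    exact Real.sqrt_le_sqrt ham
  · have hnorm : √m * √(∑ i, (t * a i) ^ 2) = t * ∑ i, a i ^ 2 := by
      have hsq : ∑ i, (t * a i) ^ 2 = t ^ 2 * m := by
        simp only [mul_pow, ← Finset.mul_sum]
        linear_combination t * htm
      rw [hsq, Real.sqrt_mul (sq_nonneg t), Real.sqrt_sq ht, htm]
      linear_combination t * Real.mul_self_sqrt hm.le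
    simp only [hx, hy, hinner]
    rw [hnorm, ← Complex.ofReal_sum, Complex.norm_of_nonneg
      (Finset.sum_nonneg fun i _ => mul_nonneg (ha0 i) (norm_nonneg _)), Finset.mul_sum,
      ← Finset.sum_add_distrib]
    exact Finset.sum_congr rfl fun i _ => heq i

/-- dual characterization of the m-distillation norm:
‖ψ‖_[m] = sup { |⟨x, ψ⟩| : ‖x‖_∞ ≤ 1, ‖x‖₂ ≤ √m }. -/
theorem mnorm_dual {d : ℕ} (ψ : Fin d → ℂ) (m : ℝ) (hm : 1 ≤ m) :
    mnorm m ψ =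
      sSup {r : ℝ | ∃ x : Fin d → ℂ, (∀ i, ‖x i‖ ≤ 1) ∧
        Real.sqrt (∑ i, ‖x i‖ ^ 2) ≤ Real.sqrt m ∧
        r = ‖∑ i, (starRingEnd ℂ) (x i) * ψ i‖} := by
  obtain ⟨x, y, z, hxy, hz, hzm, hval⟩ :=
    exists_primal_dual_optimizers ψ (zero_lt_one.trans_le hm)
  have hleast : mnorm m ψ = ‖∑ i, (starRingEnd ℂ) (z i) * ψ i‖ := by
    unfold mnorm
    refine IsLeast.csInf_eq ⟨⟨x, y, hxy, hval.symm⟩, ?_⟩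
    rintro _ ⟨x', y', rfl, rfl⟩
    exact norm_sum_conj_mul_add_le x' y' z hz hzm
  rw [hleast]
  symm
  refine IsGreatest.csSup_eq ⟨⟨z, hz, hzm, rfl⟩, ?_⟩
  rintro _ ⟨z', hz', hzm', rfl⟩
  rw [← hval, ← hxy]
  exact norm_sum_conj_mul_add_le x y z' hz' hzm'
end

section
/- For every unit vector ψ ∈ ℂ^d and every positive integer m, one has ‖ψ‖_[m] = √m if and only if ‖ψ‖_∞ ≤ 1/√m, i.e. if and only if every entry of ψ has absolute value at most 1/√m. -/
open Matrix BigOperators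

/-- Every decomposition of `ψ` bounds the distillation norm from above. -/
theorem mnorm_le {d : ℕ} (m : ℝ) {ψ x y : Fin d → ℂ} (h : x + y = ψ) :
    mnorm m ψ ≤ (∑ i, ‖x i‖) + Real.sqrt m * Real.sqrt (∑ i, ‖y i‖ ^ 2) := by
  refine csInf_le ⟨0, ?_⟩ ⟨x, y, h, rfl⟩
  rintro r ⟨u, v, -, rfl⟩
  positivity

/-- If `c * ‖ψ i‖ ≤ 1` for all `i`, pairing with the unit vector `ψ` bounds every decomposition of
`ψ` from below. -/
theorem le_sum_norm_add_mul_sqrt {d : ℕ} {ψ x y : Fin d → ℂ} (hψ : ∑ i, ‖ψ i‖ ^ 2 = 1)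
    {c : ℝ} (hc : 0 ≤ c) (hle : ∀ i, c * ‖ψ i‖ ≤ 1) (h : x + y = ψ) :
    c ≤ (∑ i, ‖x i‖) + c * Real.sqrt (∑ i, ‖y i‖ ^ 2) := by
  have hcs : ∑ i, ‖ψ i‖ * ‖y i‖ ≤ Real.sqrt (∑ i, ‖y i‖ ^ 2) := by
    simpa [hψ] using Real.sum_mul_le_sqrt_mul_sqrt Finset.univ (‖ψ ·‖) (‖y ·‖)
  calc c = ∑ i, c * ‖ψ i‖ * ‖ψ i‖ := by
        simp_rw [mul_assoc, ← Finset.mul_sum, ← sq, hψ, mul_one]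
    _ ≤ ∑ i, (‖x i‖ + c * (‖ψ i‖ * ‖y i‖)) := by
        refine Finset.sum_le_sum fun i _ => ?_
        have hi : ‖ψ i‖ ≤ ‖x i‖ + ‖y i‖ := by
          simpa [← h] using norm_add_le (x i) (y i)
        have hpos : 0 ≤ c * ‖ψ i‖ := by positivity
        nlinarith [mul_le_mul_of_nonneg_left hi hpos,
          mul_le_mul_of_nonneg_right (hle i) (norm_nonneg (x i))]
    _ = (∑ i, ‖x i‖) + c * ∑ i, ‖ψ i‖ * ‖y i‖ := by
        rw [Finset.sum_add_distrib, Finset.mul_sum]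
    _ ≤ _ := by gcongr

/-- Moving the fraction `t` of the entry `ψ i` into the `ℓ₁` part bounds the distillation norm of
the unit vector `ψ`. -/
theorem mnorm_le_of_shrink {d : ℕ} {ψ : Fin d → ℂ} (hψ : ∑ i, ‖ψ i‖ ^ 2 = 1) (m : ℝ)
    (i : Fin d) {t : ℝ} (ht : 0 ≤ t) :
    mnorm m ψ ≤ t * ‖ψ i‖ + Real.sqrt m * (1 - (2 * t - t ^ 2) * ‖ψ i‖ ^ 2 / 2) := by
  set y : Fin d → ℂ := Function.update ψ i ((1 - t : ℝ) * ψ i) with hy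
  have hxy : Pi.single i ((t : ℂ) * ψ i) + y = ψ := by
    ext j
    rcases eq_or_ne j i with rfl | hj
    · simp [hy]; ring
    · simp [hy, hj]
  have hx : ∑ j, ‖(Pi.single i ((t : ℂ) * ψ i) : Fin d → ℂ) j‖ = t * ‖ψ i‖ := by
    rw [Finset.sum_eq_single i (fun j _ hj => by simp [hj]) (by simp)]
    simp [abs_of_nonneg ht]
  have hsum : ∑ j, ‖y j‖ ^ 2 = 1 - (2 * t - t ^ 2) * ‖ψ i‖ ^ 2 := by
    have hdiff : ∑ j, (‖ψ j‖ ^ 2 - ‖y j‖ ^ 2) = ‖ψ i‖ ^ 2 - ‖y i‖ ^ 2 :=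
      Finset.sum_eq_single i (fun j _ hj => by simp [hy, hj]) (by simp)
    have hyi : ‖y i‖ ^ 2 = (1 - t) ^ 2 * ‖ψ i‖ ^ 2 := by
      rw [hy, Function.update_self, norm_mul, mul_pow, Complex.norm_real, Real.norm_eq_abs, sq_abs]
    rw [Finset.sum_sub_distrib, hψ, hyi] at hdiff
    linarith
  have hsqrt : Real.sqrt (∑ j, ‖y j‖ ^ 2) ≤ 1 - (2 * t - t ^ 2) * ‖ψ i‖ ^ 2 / 2 := by
    have hnn : 0 ≤ ∑ j, ‖y j‖ ^ 2 := by positivity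
    nlinarith [Real.sq_sqrt hnn, sq_nonneg (Real.sqrt (∑ j, ‖y j‖ ^ 2) - 1)]
  refine (mnorm_le m hxy).trans ?_
  rw [hx]
  gcongr

/-- for a unit vector ψ and positive integer m,
‖ψ‖_[m] = √m iff every entry of ψ has absolute value at most 1/√m. -/
theorem mnorm_eq_sqrt_iff {d : ℕ} (ψ : Fin d → ℂ) (hψ : ∑ i, ‖ψ i‖ ^ 2 = 1)
    (m : ℕ) (hm : 1 ≤ m) :
    mnorm (m : ℝ) ψ = Real.sqrt m ↔ ∀ i, ‖ψ i‖ ≤ 1 / Real.sqrt m := by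
  have hs : 0 < Real.sqrt m := Real.sqrt_pos.2 (by exact_mod_cast hm)
  constructor
  · intro h i
    by_contra! hi
    rw [div_lt_iff₀ hs] at hi
    set a := ‖ψ i‖
    set s := Real.sqrt m
    have hsa : 0 < a * s := by linarith
    have ha : 0 < a := pos_of_mul_pos_left hsa hs.le
    have ht : 0 < 1 - 1 / (a * s) := by
      rw [sub_pos, div_lt_one hsa]
      exact hi
    have hle := mnorm_le_of_shrink hψ m i ht.le
    rw [h] at hle
    set t := 1 - 1 / (a * s) with htdef
    have hts : a * s * t = a * s - 1 := by
      rw [htdef]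
      field_simp
    have hgain : 0 < t * a * (a * s - 1) := by
      have : 0 < a * s - 1 := by linarith
      positivity
    have hexpand : s * (1 - (2 * t - t ^ 2) * a ^ 2 / 2)
        = s - t * a * (2 * (a * s) - a * s * t) / 2 := by ring
    rw [hexpand, hts] at hle
    linarith
  · intro h
    refine le_antisymm (by simpa [hψ] using mnorm_le m (zero_add ψ)) ?_
    refine le_csInf ⟨_, 0, ψ, zero_add ψ, rfl⟩ ?_
    rintro r ⟨x, y, hxy, rfl⟩
    refine le_sum_norm_add_mul_sqrt hψ hs.le (fun i => ?_) hxy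
    rw [mul_comm]
    exact (le_div_iff₀ hs).1 (h i)
end

section
/- Strong Lagrange duality for Θ^J_m: for every real m ≥ 1 and every d×d density matrix ρ, Θ^J_m(ρ) = inf { m·Tr(ρ − X)_+ + Tr(ρ − X)_− : X Hermitian and diagonal }, where (A)_+ and (A)_− denote respectively the positive and negative parts of the Hermitian matrix A. -/
open Matrix Kronecker BigOperators ComplexOrder

/-- Θ^J_m(ρ) = sup { Re Tr(ρW) : W Hermitian, −𝟙 ≤ W ≤ m𝟙, Δ(W) = 0 }. -/
noncomputable def ThetaJ {d : ℕ} (m : ℝ) (ρ : Matrix (Fin d) (Fin d) ℂ) : ℝ :=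
  sSup {x : ℝ | ∃ W : Matrix (Fin d) (Fin d) ℂ, W.IsHermitian ∧
    (W + 1).PosSemidef ∧ ((m : ℂ) • (1 : Matrix (Fin d) (Fin d) ℂ) - W).PosSemidef ∧
    deph W = 0 ∧ x = ((ρ * W).trace).re}

section PosSemidefLemmas

variable {n : Type*} [Fintype n]

theorem isClosed_setOf_posSemidef : IsClosed {A : Matrix n n ℂ | A.PosSemidef} := by
  simp only [Matrix.posSemidef_iff_dotProduct_mulVec, Set.ofPred_and, Set.ofPred_forall]
  refine IsClosed.inter (isClosed_eq (by fun_prop) continuous_id) (isClosed_iInter fun x => ?_)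
  exact isClosed_le continuous_const
    (continuous_const.dotProduct (continuous_id.matrix_mulVec continuous_const))

variable [DecidableEq n]

open scoped MatrixOrder in
/-- A positive semidefinite matrix is a Gram matrix. -/
theorem Matrix.PosSemidef.exists_eq_conjTranspose_mul_self {A : Matrix n n ℂ}
    (hA : A.PosSemidef) : ∃ B : Matrix n n ℂ, A = Bᴴ * B :=
  CStarAlgebra.nonneg_iff_eq_star_mul_self.mp (Matrix.nonneg_iff_posSemidef.mpr hA)

theorem Matrix.PosSemidef.re_trace_mul_nonneg {A B : Matrix n n ℂ}
    (hA : A.PosSemidef) (hB : B.PosSemidef) : 0 ≤ (A * B).trace.re := by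
  obtain ⟨C, rfl⟩ := hA.exists_eq_conjTranspose_mul_self
  rw [Matrix.mul_assoc, Matrix.trace_mul_comm]
  exact (Complex.le_def.mp (hB.mul_mul_conjTranspose_same C).trace_nonneg).1

theorem Matrix.PosSemidef.norm_apply_le {A : Matrix n n ℂ} (hA : A.PosSemidef) (i j : n) :
    ‖A i j‖ ≤ ((A i i).re + (A j j).re) / 2 := by
  obtain ⟨B, rfl⟩ := hA.exists_eq_conjTranspose_mul_self
  have hdiag (k : n) : ((Bᴴ * B) k k).re = ∑ l, ‖B l k‖ ^ 2 := by
    simp [Matrix.mul_apply, ← Complex.normSq_eq_norm_sq, Complex.normSq_apply]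
  rw [hdiag, hdiag, ← Finset.sum_add_distrib, Finset.sum_div, Matrix.mul_apply]
  refine (norm_sum_le _ _).trans (Finset.sum_le_sum fun l _ => ?_)
  simp only [Matrix.conjTranspose_apply, norm_mul, norm_star]
  nlinarith [sq_nonneg (‖B l i‖ - ‖B l j‖)]

/-- The matrices `W` with `-1 ≤ W ≤ m`. -/
def orderInterval (n : Type*) [Fintype n] [DecidableEq n] (m : ℝ) : Set (Matrix n n ℂ) :=
  {W | (W + 1).PosSemidef ∧ ((m : ℂ) • (1 : Matrix n n ℂ) - W).PosSemidef}

theorem isHermitian_of_mem_orderInterval {m : ℝ} {W : Matrix n n ℂ}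
    (hW : W ∈ orderInterval n m) : W.IsHermitian := by
  simpa using hW.1.isHermitian.sub Matrix.isHermitian_one

theorem zero_mem_orderInterval {m : ℝ} (hm : 0 ≤ m) :
    (0 : Matrix n n ℂ) ∈ orderInterval n m := by
  refine ⟨by simpa using Matrix.PosSemidef.one, ?_⟩
  rw [sub_zero]
  exact Matrix.PosSemidef.one.smul (Complex.zero_le_real.mpr hm)

theorem convex_orderInterval (m : ℝ) : Convex ℝ (orderInterval n m) := by
  intro V hV W hW a b ha hb hab
  constructor
  · convert (hV.1.smul ha).add (hW.1.smul hb) using 1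
    rw [smul_add, smul_add, add_add_add_comm, ← add_smul, hab, one_smul]
  · convert (hV.2.smul ha).add (hW.2.smul hb) using 1
    rw [smul_sub, smul_sub, sub_add_sub_comm, ← add_smul, hab, one_smul]

theorem isCompact_orderInterval (m : ℝ) : IsCompact (orderInterval n m) := by
  have hclosed : IsClosed (orderInterval n m) :=
    (isClosed_setOf_posSemidef.preimage (by fun_prop : Continuous fun W : Matrix n n ℂ => W + 1)).inter
      (isClosed_setOf_posSemidef.preimage
        (by fun_prop : Continuous fun W : Matrix n n ℂ => (m : ℂ) • (1 : Matrix n n ℂ) - W))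
  have hbound (W : Matrix n n ℂ) (hW : W ∈ orderInterval n m) (i j : n) : ‖W i j‖ ≤ m + 2 := by
    have hdiag (k : n) : (W k k).re ≤ m := by
      simpa using (Complex.le_def.mp (hW.2.diag_nonneg (i := k))).1
    have hentry := hW.1.norm_apply_le i j
    have hone : ‖(1 : Matrix n n ℂ) i j‖ ≤ 1 := by
      rw [Matrix.one_apply]
      split_ifs <;> simp
    have htri : ‖W i j‖ ≤ ‖(W + 1) i j‖ + ‖(1 : Matrix n n ℂ) i j‖ := by
      simpa using norm_sub_le ((W + 1) i j) ((1 : Matrix n n ℂ) i j)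
    simp only [Matrix.add_apply, Matrix.one_apply_eq, Complex.add_re, Complex.one_re]
      at hentry htri
    linarith [hdiag i, hdiag j]
  have hbox : IsCompact (Set.univ.pi fun _ : n => Set.univ.pi fun _ : n =>
      Metric.closedBall (0 : ℂ) (m + 2)) :=
    isCompact_univ_pi fun _ => isCompact_univ_pi fun _ => isCompact_closedBall _ _
  exact hbox.of_isClosed_subset hclosed fun W hW i _ j _ =>
    mem_closedBall_zero_iff.mpr (hbound W hW i j)

/-- The Jordan decomposition `A = P - N`, with a matrix `W`, `-1 ≤ W ≤ m`, for which
`Re Tr(AW)` equals `m Tr P + Tr N`. -/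
theorem Matrix.IsHermitian.exists_jordan_decomposition {A : Matrix n n ℂ} (hA : A.IsHermitian)
    {m : ℝ} (hm : -1 ≤ m) :
    ∃ P N W : Matrix n n ℂ, P.PosSemidef ∧ N.PosSemidef ∧ A = P - N ∧ P * N = 0 ∧
      W ∈ orderInterval n m ∧ (A * W).trace.re = m * P.trace.re + N.trace.re := by
  let c := Unitary.conjStarAlgAut ℂ (Matrix n n ℂ) hA.eigenvectorUnitary
  let F : (n → ℝ) → Matrix n n ℂ := fun g => c (Matrix.diagonal fun i => (g i : ℂ))
  have hpos (g : n → ℝ) (hg : ∀ i, 0 ≤ g i) : (F g).PosSemidef := by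
    have := Matrix.PosSemidef.diagonal (d := fun i => (g i : ℂ))
      fun i => Complex.zero_le_real.mpr (hg i)
    simpa [F, c, Unitary.conjStarAlgAut_apply, Matrix.star_eq_conjTranspose] using
      this.mul_mul_conjTranspose_same (hA.eigenvectorUnitary : Matrix n n ℂ)
  have hsub (g h : n → ℝ) : F g - F h = F (g - h) := by
    simp only [F, ← map_sub, Matrix.diagonal_sub, Pi.sub_apply, Complex.ofReal_sub]
  have hadd (g h : n → ℝ) : F g + F h = F (g + h) := by
    simp only [F, ← map_add, Matrix.diagonal_add, Pi.add_apply, Complex.ofReal_add]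
  have hmul (g h : n → ℝ) : F g * F h = F (g * h) := by
    simp only [F, ← map_mul, Matrix.diagonal_mul_diagonal, Pi.mul_apply, Complex.ofReal_mul]
  have hconst (r : ℝ) : F (fun _ => r) = (r : ℂ) • (1 : Matrix n n ℂ) := by
    simp only [F, ← Matrix.smul_one_eq_diagonal, map_smul, map_one]
  have htrace (g : n → ℝ) : (F g).trace.re = ∑ i, g i := by
    simp only [F, c, Unitary.conjStarAlgAut_apply]
    rw [Matrix.trace_mul_cycle, Unitary.coe_star_mul_self, Matrix.one_mul, Matrix.trace_diagonal]
    simp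
  have hA' : A = F hA.eigenvalues := hA.spectral_theorem
  set l := hA.eigenvalues
  refine ⟨F fun i => max (l i) 0, F fun i => max (-l i) 0, F fun i => if 0 ≤ l i then m else -1,
    hpos _ fun _ => le_max_right _ _, hpos _ fun _ => le_max_right _ _, ?_, ?_, ⟨?_, ?_⟩, ?_⟩
  · rw [hsub, hA']
    congr 1
    ext i
    simp only [Pi.sub_apply]
    rcases le_total 0 (l i) with h | h <;> simp [h]
  · rw [hmul]
    have : ((fun i => max (l i) 0) * fun i => max (-l i) 0) = fun _ => (0 : ℝ) := by
      ext i
      simp only [Pi.mul_apply]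
      rcases le_total 0 (l i) with h | h <;> simp [h]
    rw [this, hconst]
    simp
  · have h1 := hconst 1
    rw [Complex.ofReal_one, one_smul] at h1
    rw [← h1, hadd]
    refine hpos _ fun i => ?_
    simp only [Pi.add_apply]
    split_ifs <;> linarith
  · rw [← hconst, hsub]
    refine hpos _ fun i => ?_
    simp only [Pi.sub_apply]
    split_ifs <;> linarith
  · rw [hA', hmul, htrace, htrace, htrace, Finset.mul_sum, ← Finset.sum_add_distrib]
    refine Finset.sum_congr rfl fun i _ => ?_
    simp only [Pi.mul_apply]
    split_ifs with h
    · rw [max_eq_left h, max_eq_right (by linarith)]; ring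
    · rw [max_eq_right (by linarith), max_eq_left (by linarith)]; ring

end PosSemidefLemmas

/-- Weak duality. -/
theorem re_trace_mul_le_of_jordan_decomposition {d : ℕ} {m : ℝ}
    {ρ W X P N : Matrix (Fin d) (Fin d) ℂ} (hW : W ∈ orderInterval (Fin d) m)
    (hdiag : deph W = 0) (hX : X = deph X) (hP : P.PosSemidef) (hN : N.PosSemidef)
    (hsub : ρ - X = P - N) : (ρ * W).trace.re ≤ m * P.trace.re + N.trace.re := by
  have hXW : (X * W).trace = 0 := by
    have hW0 (i : Fin d) : W i i = 0 := congrFun (Matrix.diagonal_eq_zero.mp hdiag) i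
    rw [hX, deph, Matrix.trace]
    simp [Matrix.diagonal_mul, hW0]
  have hPW := hP.re_trace_mul_nonneg hW.2
  have hNW := hN.re_trace_mul_nonneg hW.1
  rw [show ρ = P - N + X by rw [← hsub, sub_add_cancel]]
  simp only [Matrix.mul_sub, Matrix.mul_add, Matrix.sub_mul, Matrix.add_mul, Matrix.trace_sub,
    Matrix.trace_add, Matrix.mul_smul, Matrix.trace_smul, Matrix.mul_one, hXW, smul_eq_mul,
    Complex.sub_re, Complex.add_re, Complex.re_ofReal_mul, Complex.zero_re] at hPW hNW ⊢
  linarith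

/-- The objective value and the diagonal, as a linear function of the matrix. -/
noncomputable def traceDiag {d : ℕ} (ρ : Matrix (Fin d) (Fin d) ℂ) :
    Matrix (Fin d) (Fin d) ℂ →ₗ[ℝ] ℝ × (Fin d → ℝ) where
  toFun W := ((ρ * W).trace.re, fun i => (W i i).re)
  map_add' V W := by ext <;> simp [Matrix.mul_add]
  map_smul' r W := by ext <;> simp

/-- If `v` bounds the objective strictly on the feasible set, a diagonal perturbation of `ρ`
makes `v` a bound on all of the order interval. -/
theorem exists_diagonal_bound {d : ℕ} {m v : ℝ} (hm : 0 ≤ m) {ρ : Matrix (Fin d) (Fin d) ℂ}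
    (hv : ∀ W ∈ orderInterval (Fin d) m, deph W = 0 → (ρ * W).trace.re < v) :
    ∃ y : Fin d → ℝ, ∀ W ∈ orderInterval (Fin d) m,
      ((ρ - Matrix.diagonal fun i => (y i : ℂ)) * W).trace.re ≤ v := by
  have hcont : Continuous (traceDiag ρ) := by
    change Continuous fun W : Matrix (Fin d) (Fin d) ℂ =>
      ((ρ * W).trace.re, fun i => (W i i).re)
    fun_prop
  have hnot : ((v, 0) : ℝ × (Fin d → ℝ)) ∉ traceDiag ρ '' orderInterval (Fin d) m := by
    rintro ⟨W, hW, hWv⟩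
    obtain ⟨h1, h2⟩ := Prod.ext_iff.mp hWv
    refine (hv W hW ?_).ne h1
    refine Matrix.diagonal_eq_zero.mpr (funext fun i => Complex.ext (congrFun h2 i) ?_)
    exact Complex.conj_eq_iff_im.mp ((isHermitian_of_mem_orderInterval hW).apply i i)
  obtain ⟨f, u, hlt, hu⟩ := geometric_hahn_banach_closed_point
    ((convex_orderInterval m).linear_image (traceDiag ρ))
    ((isCompact_orderInterval m).image hcont).isClosed hnot
  set a := f (1, 0) with ha
  set y : Fin d → ℝ := fun i => f (0, Pi.single i 1) with hy
  have hf (t : ℝ) (z : Fin d → ℝ) : f (t, z) = t * a + ∑ i, z i * y i := by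
    have hdecomp : ((t, z) : ℝ × (Fin d → ℝ)) =
        t • ((1, 0) : ℝ × (Fin d → ℝ)) +
          ∑ i, z i • ((0, Pi.single i 1) : ℝ × (Fin d → ℝ)) := by
      ext j
      · simp [Prod.fst_sum]
      · simp [Prod.snd_sum, Finset.sum_apply, Pi.single_apply]
    rw [hdecomp, map_add, map_sum, map_smul]
    simp only [map_smul, smul_eq_mul, ha, hy]
  have hv0 : 0 < v := by
    simpa using hv 0 (zero_mem_orderInterval hm) (by simp [deph])
  have hfv : f (v, 0) = v * a := by simp [hf]
  have hu0 : 0 < u := by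
    simpa using hlt _ ⟨0, zero_mem_orderInterval hm, map_zero _⟩
  have ha0 : 0 < a := pos_of_mul_pos_right (hfv ▸ hu0.trans hu) hv0.le
  refine ⟨fun i => -(y i / a), fun W hW => ?_⟩
  have hWlt : (ρ * W).trace.re * a + ∑ i, (W i i).re * y i < v * a :=
    hf _ _ ▸ hfv ▸ (hlt _ ⟨W, hW, rfl⟩).trans hu
  have htr : ((ρ - Matrix.diagonal fun i => ((-(y i / a) : ℝ) : ℂ)) * W).trace.re =
      (ρ * W).trace.re + (∑ i, (W i i).re * y i) / a := by
    rw [Matrix.sub_mul, Matrix.trace_sub, Complex.sub_re, sub_eq_add_neg, Finset.sum_div]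
    congr 1
    simp only [Matrix.trace, Matrix.diag_apply, Matrix.diagonal_mul, Complex.re_sum,
      Complex.re_ofReal_mul, ← Finset.sum_neg_distrib]
    exact Finset.sum_congr rfl fun i _ => by ring
  rw [htr, ← mul_le_mul_iff_left₀ ha0, add_mul, div_mul_cancel₀ _ ha0.ne']
  exact hWlt.le

/-- strong Lagrange duality for Θ^J_m:
Θ^J_m(ρ) = inf { m·Tr(ρ−X)_+ + Tr(ρ−X)_− : X Hermitian and diagonal }, where
(ρ−X) = P − N is the unique decomposition into mutually orthogonal positive and
negative parts P, N. -/
theorem thetaJ_duality {d : ℕ} (m : ℝ) (hm : 1 ≤ m)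
    (ρ : Matrix (Fin d) (Fin d) ℂ) (hρ : IsDensity ρ) :
    ThetaJ m ρ =
      sInf {x : ℝ | ∃ X P N : Matrix (Fin d) (Fin d) ℂ,
        X.IsHermitian ∧ X = deph X ∧
        P.PosSemidef ∧ N.PosSemidef ∧ ρ - X = P - N ∧ P * N = 0 ∧
        x = m * P.trace.re + N.trace.re} := by
  have hm0 : 0 ≤ m := zero_le_one.trans hm
  have hzero : (0 : Matrix (Fin d) (Fin d) ℂ) ∈ orderInterval (Fin d) m :=
    zero_mem_orderInterval hm0
  have hdeph : deph (0 : Matrix (Fin d) (Fin d) ℂ) = 0 := by simp [deph]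
  apply le_antisymm
  · refine csSup_le ⟨_, 0, Matrix.isHermitian_zero, hzero.1, hzero.2, hdeph, rfl⟩ ?_
    rintro _ ⟨W, -, hW1, hW2, hW3, rfl⟩
    refine le_csInf ⟨_, 0, ρ, 0, Matrix.isHermitian_zero, hdeph.symm, hρ.1,
      Matrix.PosSemidef.zero, rfl, Matrix.mul_zero _, rfl⟩ ?_
    rintro _ ⟨X, P, N, -, hX, hP, hN, hsub, -, rfl⟩
    exact re_trace_mul_le_of_jordan_decomposition ⟨hW1, hW2⟩ hW3 hX hP hN hsub
  · refine le_of_forall_pos_le_add fun ε hε => ?_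
    have hlt (W) (hW : W ∈ orderInterval (Fin d) m) (hWd : deph W = 0) :
        (ρ * W).trace.re < ThetaJ m ρ + ε := by
      refine lt_add_of_le_of_pos (le_csSup ⟨m * ρ.trace.re + (0 : Matrix (Fin d) (Fin d) ℂ).trace.re, ?_⟩
        ⟨W, isHermitian_of_mem_orderInterval hW, hW.1, hW.2, hWd, rfl⟩) hε
      rintro _ ⟨V, -, hV1, hV2, hV3, rfl⟩
      exact re_trace_mul_le_of_jordan_decomposition ⟨hV1, hV2⟩ hV3 hdeph.symm hρ.1
        Matrix.PosSemidef.zero rfl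
    obtain ⟨y, hy⟩ := exists_diagonal_bound hm0 hlt
    have hXherm : (Matrix.diagonal fun i => (y i : ℂ)).IsHermitian :=
      Matrix.isHermitian_diagonal_of_self_adjoint _ (funext fun i => Complex.conj_ofReal _)
    obtain ⟨P, N, W, hP, hN, hsub, hPN, hW, htr⟩ :=
      (hρ.1.isHermitian.sub hXherm).exists_jordan_decomposition
        (show -1 ≤ m by linarith)
    refine le_trans (csInf_le ⟨0, ?_⟩ ?_) (htr ▸ hy W hW)
    swap
    · exact ⟨_, P, N, hXherm, by simp [deph], hP, hN, hsub, hPN, rfl⟩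
    rintro _ ⟨X, P, N, -, hX, hP, hN, hsub, -, rfl⟩
    simpa using re_trace_mul_le_of_jordan_decomposition hzero hdeph hX hP hN hsub
end

section
/- Minimax identity underlying the hypothesis-testing characterization of one-shot distillable coherence: for every d×d density matrix ρ and every ε ∈ [0,1), inf { k ∈ ℝ : ∃ G Hermitian with 0 ≤ G ≤ 𝟙, Re Tr(ρG) ≥ 1 − ε, and Δ(G) = k𝟙 } = sup over Hermitian diagonal d×d matrices M with Tr M = 1 of inf { Re Tr(MG) : G Hermitian, 0 ≤ G ≤ 𝟙, Re Tr(ρG) ≥ 1 − ε } (both sides interpreted in the extended reals, with inf over the empty set equal to +∞). -/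
open Matrix Kronecker BigOperators ComplexOrder

/-- A compact convex set of real vectors that contains the all-ones vector but no constant vector
with value at most `t` lies in a half-space `t ≤ ∑ i, m i * s i` with normalized `m`. -/
lemma exists_normalized_separating_weights {ι : Type*} [Fintype ι] {S : Set (ι → ℝ)}
    (hconv : Convex ℝ S) (hcomp : IsCompact S) (hone : (1 : ι → ℝ) ∈ S) {t : ℝ}
    (ht : ∀ k ≤ t, k • (1 : ι → ℝ) ∉ S) :
    ∃ m : ι → ℝ, ∑ i, m i = 1 ∧ ∀ s ∈ S, t ≤ ∑ i, m i * s i := by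
  classical
  have hone_ne : (1 : ι → ℝ) ≠ 0 := by
    intro h
    exact ht t le_rfl (by simpa [h] using hone)
  have hray_closed : IsClosed ((fun k : ℝ => k • (1 : ι → ℝ)) '' Set.Iic t) :=
    (isClosedEmbedding_smul_left hone_ne).isClosedMap _ isClosed_Iic
  have hray_conv : Convex ℝ ((fun k : ℝ => k • (1 : ι → ℝ)) '' Set.Iic t) :=
    (convex_Iic t).is_linear_image ⟨fun a b => add_smul a b _, fun a b => smul_assoc a b _⟩
  have hdisj : Disjoint S ((fun k : ℝ => k • (1 : ι → ℝ)) '' Set.Iic t) := by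
    rw [Set.disjoint_right]
    rintro _ ⟨k, hk, rfl⟩
    exact ht k hk
  obtain ⟨f, u, v, hfu, huv, hfv⟩ :=
    geometric_hahn_banach_compact_closed hconv hcomp hray_conv hray_closed hdisj
  have hray (k : ℝ) (hk : k ≤ t) : v < k * f 1 := by
    simpa using hfv _ ⟨k, hk, rfl⟩
  have hneg : f 1 < 0 := by
    by_contra! hnonneg
    have h₁ := hfu 1 hone
    have h₂ := hray (min t 1) (min_le_left _ _)
    have h₃ : min t 1 * f 1 ≤ 1 * f 1 := by gcongr; exact min_le_right _ _
    linarith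
  have hf (s : ι → ℝ) : ∑ i, f (Pi.single i 1) * s i = f s := by
    conv_rhs => rw [← Finset.univ_sum_single s, map_sum]
    refine Finset.sum_congr rfl fun i _ => ?_
    rw [mul_comm, ← smul_eq_mul, ← map_smul, ← Pi.single_smul, smul_eq_mul, mul_one]
  refine ⟨fun i => f (Pi.single i 1) / f 1, ?_, fun s hs => ?_⟩
  · rw [← Finset.sum_div, div_eq_one_iff_eq hneg.ne]
    simpa using hf 1
  · simp_rw [div_mul_eq_mul_div]
    rw [← Finset.sum_div, hf, le_div_iff_of_neg hneg]
    linarith [hfu s hs, hray t le_rfl]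

section Effects

open scoped MatrixOrder Matrix.Norms.L2Operator

/-- The tests `0 ≤ G ≤ 1` accepting `ρ` with probability at least `1 - ε`. -/
def testSet {n : Type*} [Fintype n] [DecidableEq n] (ρ : Matrix n n ℂ) (ε : ℝ) :
    Set (Matrix n n ℂ) :=
  Set.Icc 0 1 ∩ {G | 1 - ε ≤ (ρ * G).trace.re}

lemma mem_testSet {n : Type*} [Fintype n] [DecidableEq n] {ρ G : Matrix n n ℂ} {ε : ℝ} :
    G ∈ testSet ρ ε ↔ G.IsHermitian ∧ G.PosSemidef ∧ (1 - G).PosSemidef ∧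
      1 - ε ≤ (ρ * G).trace.re := by
  simp only [testSet, Set.mem_inter_iff, Set.mem_Icc, Matrix.le_iff, sub_zero,
    Set.mem_ofPred_eq, and_assoc]
  exact ⟨fun h => ⟨h.1.isHermitian, h⟩, fun h => h.2⟩

lemma isCompact_testSet {n : Type*} [Fintype n] [DecidableEq n] (ρ : Matrix n n ℂ) (ε : ℝ) :
    IsCompact (testSet ρ ε) := by
  have : ProperSpace (Matrix n n ℂ) := FiniteDimensional.proper ℂ _
  have hIcc : IsCompact (Set.Icc (0 : Matrix n n ℂ) 1) := by
    refine (isCompact_closedBall (0 : Matrix n n ℂ) 1).of_isClosed_subset isClosed_Icc ?_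
    intro G hG
    rw [mem_closedBall_zero_iff]
    exact (CStarAlgebra.norm_le_one_iff_of_nonneg G hG.1).2 hG.2
  exact hIcc.inter_right (isClosed_le continuous_const (by fun_prop))

lemma convex_testSet {n : Type*} [Fintype n] [DecidableEq n] (ρ : Matrix n n ℂ) (ε : ℝ) :
    Convex ℝ (testSet ρ ε) := by
  refine (convex_Icc _ _).inter (convex_halfSpace_ge ⟨fun A B => ?_, fun c A => ?_⟩ _)
  · simp [mul_add]
  · simp

end Effects

lemma re_trace_diagonal_mul {n : Type*} [Fintype n] [DecidableEq n] (m : n → ℝ)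
    (G : Matrix n n ℂ) :
    (Matrix.diagonal (fun i => (m i : ℂ)) * G).trace.re = ∑ i, m i * (G i i).re := by
  simp [Matrix.trace, Matrix.diagonal_mul]

/-- minimax identity underlying the hypothesis-testing characterization of
one-shot distillable coherence:
inf { k : ∃ G, 0 ≤ G ≤ 𝟙, Re Tr(ρG) ≥ 1−ε, Δ(G) = k𝟙 }
  = sup_{M diag Herm, Tr M = 1} inf { Re Tr(MG) : 0 ≤ G ≤ 𝟙, Re Tr(ρG) ≥ 1−ε }. -/
theorem minimax_hypothesis_testing {d : ℕ}
    (ρ : Matrix (Fin d) (Fin d) ℂ) (hρ : IsDensity ρ)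
    (ε : ℝ) (hε0 : 0 ≤ ε) (hε1 : ε < 1) :
    sInf {k : ℝ | ∃ G : Matrix (Fin d) (Fin d) ℂ, G.IsHermitian ∧
        G.PosSemidef ∧ (1 - G).PosSemidef ∧ 1 - ε ≤ ((ρ * G).trace).re ∧
        deph G = ((k : ℂ)) • (1 : Matrix (Fin d) (Fin d) ℂ)} =
      sSup {y : ℝ | ∃ M : Matrix (Fin d) (Fin d) ℂ, M.IsHermitian ∧ M = deph M ∧
        M.trace = 1 ∧
        y = sInf {z : ℝ | ∃ G : Matrix (Fin d) (Fin d) ℂ, G.IsHermitian ∧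
          G.PosSemidef ∧ (1 - G).PosSemidef ∧ 1 - ε ≤ ((ρ * G).trace).re ∧
          z = ((M * G).trace).re}} := by
  have hmem (G : Matrix (Fin d) (Fin d) ℂ) := mem_testSet (ρ := ρ) (G := G) (ε := ε)
  have hone : (1 : Matrix (Fin d) (Fin d) ℂ) ∈ testSet ρ ε := by
    rw [hmem]
    exact ⟨isHermitian_one, PosSemidef.one, by simpa using PosSemidef.zero, by simp [hρ.2, hε0]⟩
  have : NeZero d := ⟨by
    rintro rfl
    simpa using hρ.2⟩
  let L : Set ℝ := {k : ℝ | ∃ G : Matrix (Fin d) (Fin d) ℂ, G.IsHermitian ∧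
    G.PosSemidef ∧ (1 - G).PosSemidef ∧ 1 - ε ≤ ((ρ * G).trace).re ∧
    deph G = ((k : ℂ)) • (1 : Matrix (Fin d) (Fin d) ℂ)}
  have hL_one : (1 : ℝ) ∈ L := by
    obtain ⟨h₁, h₂, h₃, h₄⟩ := (hmem 1).1 hone
    exact ⟨1, h₁, h₂, h₃, h₄, by simp [deph]⟩
  have hL_bdd : BddBelow L := by
    refine ⟨0, ?_⟩
    rintro k ⟨G, -, hG, -, -, hk⟩
    have h : G 0 0 = k := by simpa [deph] using congr_fun₂ hk 0 0
    have h₀ := hG.diag_nonneg (i := 0)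
    rw [h] at h₀
    exact_mod_cast h₀
  let value (M : Matrix (Fin d) (Fin d) ℂ) : Set ℝ :=
    {z : ℝ | ∃ G : Matrix (Fin d) (Fin d) ℂ, G.IsHermitian ∧ G.PosSemidef ∧
      (1 - G).PosSemidef ∧ 1 - ε ≤ ((ρ * G).trace).re ∧ z = ((M * G).trace).re}
  have hvalue_bdd (M : Matrix (Fin d) (Fin d) ℂ) : BddBelow (value M) := by
    have hbdd := ((isCompact_testSet ρ ε).image_of_continuousOn
      (f := fun G => ((M * G).trace).re) (by fun_prop)).bddBelow
    refine hbdd.mono ?_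
    rintro _ ⟨G, h₁, h₂, h₃, h₄, rfl⟩
    exact ⟨G, (hmem G).2 ⟨h₁, h₂, h₃, h₄⟩, rfl⟩
  have hvalue_le (M : Matrix (Fin d) (Fin d) ℂ) (hM : M = deph M) (htr : M.trace = 1)
      (k : ℝ) (hk : k ∈ L) : sInf (value M) ≤ k := by
    obtain ⟨G, h₁, h₂, h₃, h₄, hG⟩ := hk
    refine csInf_le (hvalue_bdd M) ⟨G, h₁, h₂, h₃, h₄, ?_⟩
    have hdiag (i : Fin d) : G i i = k := by
      simpa [deph] using congr_fun₂ hG i i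
    have htrace : (M * G).trace = k := by
      rw [hM]
      simp only [deph, trace, diag_apply, diagonal_mul, hdiag, ← Finset.sum_mul]
      rw [show ∑ i, M i i = 1 from htr, one_mul]
    simp [htrace]
  refine le_antisymm (le_of_forall_lt fun t ht => ?_) ?_
  · obtain ⟨t', htt', ht'⟩ := exists_between ht
    let diagRe : Matrix (Fin d) (Fin d) ℂ →ₗ[ℝ] (Fin d → ℝ) :=
      { toFun := fun G i => (G i i).re
        map_add' := fun A B => by ext; simp
        map_smul' := fun c A => by ext; simp }
    obtain ⟨m, hm_sum, hm⟩ := exists_normalized_separating_weights (t := t')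
      ((convex_testSet ρ ε).linear_image diagRe)
      ((isCompact_testSet ρ ε).image_of_continuousOn
        (f := diagRe) diagRe.continuous_of_finiteDimensional.continuousOn)
      ⟨1, hone, by ext; simp [diagRe]⟩ (by
        rintro k hk ⟨G, hG, hGk⟩
        obtain ⟨h₁, h₂, h₃, h₄⟩ := (hmem G).1 hG
        refine (hk.trans_lt ht').not_ge (csInf_le hL_bdd ⟨G, h₁, h₂, h₃, h₄, ?_⟩)
        rw [deph, smul_one_eq_diagonal]
        congr 1
        ext1 i
        rw [← h₁.coe_re_apply_self i]
        exact congrArg _ (by simpa [diagRe] using congr_fun hGk i))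
    refine htt'.trans_le (le_csSup_of_le ⟨1, ?_⟩
      ⟨diagonal fun i => (m i : ℂ), ?_, ?_, ?_, rfl⟩ (le_csInf ?_ ?_))
    · rintro _ ⟨M, -, hM, htr, rfl⟩
      exact hvalue_le M hM htr 1 hL_one
    · exact isHermitian_diagonal_of_self_adjoint _ (by ext; simp)
    · simp [deph]
    · rw [trace_diagonal]
      exact_mod_cast hm_sum
    · obtain ⟨h₁, h₂, h₃, h₄⟩ := (hmem 1).1 hone
      exact ⟨_, 1, h₁, h₂, h₃, h₄, rfl⟩
    · rintro _ ⟨G, h₁, h₂, h₃, h₄, rfl⟩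
      rw [re_trace_diagonal_mul]
      exact hm _ ⟨G, (hmem G).2 ⟨h₁, h₂, h₃, h₄⟩, rfl⟩
  · refine csSup_le ?_ ?_
    · refine ⟨_, diagonal (Pi.single 0 1), ?_, ?_, ?_, rfl⟩
      · exact isHermitian_diagonal_of_self_adjoint _ (by simp [IsSelfAdjoint])
      · simp [deph]
      · simp [trace_diagonal]
    · rintro _ ⟨M, -, hM, htr, rfl⟩
      exact le_csInf ⟨1, hL_one⟩ (hvalue_le M hM htr)
end
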